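/- Let d ≥ 3 be an integer, let a > -((d-2)/2)² be real, and let δ₀ ∈ (0,1). Let W := W_{min(a,0)} be the ground state soliton with coupling min(a,0), K := Q_{min(a,0)}(W), and E_W := E_{min(a,0)}(W) = K/d. Then there exist constants δ₁ > 0 and c > 0, depending only on d, a, δ₀, such that for every f ∈ C_c^∞(ℝ^d \ {0}; ℂ) satisfying E_a(f) ≤ (1-δ₀) E_W and Q_a(f) ≤ K, one has: (1) Q_a(f) ≤ (1-δ₁) K; (2) ∫_{ℝ^d} (|∇f|² + (a/|x|²)|f|² - |f|^{2d/(d-2)}) dx ≥ c · Q_a(f); and (3) c · Q_a(f) ≤ 2E_a(f) ≤ Q_a(f). -/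

import Mathlib

open MeasureTheory

/-- One-dimensional monotone transport of a compactly supported continuous density `μ` onto the
restriction of a positive continuous density `ρ` to `[-L, L]`. -/
theorem exists_monotone_transport {ρ μ : ℝ → ℝ} (hρ : Continuous ρ) (hρ0 : ∀ y, 0 < ρ y)
    (hμ : Continuous μ) (hμ0 : ∀ x, 0 ≤ μ x) (hμc : HasCompactSupport μ) (hM : 0 < ∫ x, μ x)
    {L : ℝ} (hL : 0 < L) :
    ∃ T : ℝ → ℝ,
      (∀ x, HasDerivAt T (((∫ y in -L..L, ρ y) / (∫ x, μ x)) * (μ x / ρ (T x))) x) ∧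
      ∀ ψ : ℝ → ℝ, Continuous ψ →
        ∫ x, μ x * ψ (T x) = ((∫ x, μ x) / ∫ y in -L..L, ρ y) * ∫ y in -L..L, ψ y * ρ y := by
  set M := ∫ x, μ x with hMdef
  set Z := ∫ y in -L..L, ρ y with hZdef
  have hZ : 0 < Z := intervalIntegral.intervalIntegral_pos_of_pos
    (hρ.intervalIntegrable _ _) hρ0 (by linarith)
  -- extend `ρ` from `[-L, L]` by constants, so that its primitive is a bijection of `ℝ`
  set r : ℝ → ℝ := fun y => ρ (max (-L) (min L y)) with hr
  have hrc : Continuous r := by fun_prop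
  have hr0 : ∀ y, 0 < r y := fun y => hρ0 _
  have hrρ : ∀ y ∈ Set.Icc (-L) L, r y = ρ y := by
    intro y hy
    simp [hr, min_eq_right hy.2, max_eq_right hy.1]
  set G : ℝ → ℝ := fun y => ∫ t in -L..y, r t with hG
  have hGd : ∀ y, HasDerivAt G (r y) y := fun y =>
    intervalIntegral.integral_hasDerivAt_right (hrc.intervalIntegrable _ _)
      (hrc.stronglyMeasurableAtFilter _ _) hrc.continuousAt
  have hGc : Continuous G := continuous_iff_continuousAt.2 fun y => (hGd y).continuousAt
  have hGm : StrictMono G := strictMono_of_hasDerivAt_pos hGd hr0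
  have hGL : G (-L) = 0 := by simp [hG]
  have hGZ : G L = Z := by
    refine intervalIntegral.integral_congr fun y hy => ?_
    rw [Set.uIcc_of_le (by linarith)] at hy
    exact hrρ y hy
  have hup : ∀ y, L ≤ y → G y = Z + (y - L) * ρ L := by
    intro y hy
    rw [← hGZ, hG]
    simp only
    rw [← intervalIntegral.integral_add_adjacent_intervals
      (hrc.intervalIntegrable (-L) L) (hrc.intervalIntegrable L y)]
    congr 1
    rw [show ∫ t in L..y, r t = ∫ t in L..y, ρ L from
      intervalIntegral.integral_congr fun t ht => ?_]
    · simp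
    · rw [Set.uIcc_of_le hy] at ht
      simp [hr, min_eq_left ht.1, max_eq_right (by linarith : -L ≤ L)]
  have hdown : ∀ y, y ≤ -L → G y = (y + L) * ρ (-L) := by
    intro y hy
    rw [hG]
    simp only
    rw [show ∫ t in -L..y, r t = ∫ t in -L..y, ρ (-L) from
      intervalIntegral.integral_congr fun t ht => ?_]
    · simp
    · rw [Set.uIcc_of_ge hy] at ht
      have : min L t ≤ -L := (min_le_right _ _).trans ht.2
      simp [hr, max_eq_left this]
  have hsurj : Function.Surjective G := by
    refine hGc.surjective ?_ ?_
    · refine Filter.Tendsto.congr' (f₁ := fun y => Z + (y - L) * ρ L) ?_ ?_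
      · filter_upwards [Filter.eventually_ge_atTop L] with y hy using (hup y hy).symm
      · exact Filter.tendsto_atTop_add_const_left _ _
          ((Filter.tendsto_atTop_add_const_right _ _ Filter.tendsto_id).atTop_mul_const (hρ0 L))
    · refine Filter.Tendsto.congr' (f₁ := fun y => (y + L) * ρ (-L)) ?_ ?_
      · filter_upwards [Filter.eventually_le_atBot (-L)] with y hy using (hdown y hy).symm
      · exact (Filter.tendsto_atBot_add_const_right _ _ Filter.tendsto_id).atBot_mul_const
          (hρ0 (-L))
  set e := hGm.orderIsoOfSurjective G hsurj with he
  have heG : ∀ y, G (e.symm y) = y := fun y => e.apply_symm_apply y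
  have heG' : ∀ y, e.symm (G y) = y := fun y => e.symm_apply_apply y
  have hinv : ∀ u, HasDerivAt e.symm (r (e.symm u))⁻¹ u := fun u =>
    HasDerivAt.of_local_left_inverse e.symm.continuous.continuousAt (hGd _) (hr0 _).ne'
      (Filter.Eventually.of_forall heG)
  -- an interval containing the support of `μ`
  obtain ⟨A, hA⟩ : ∃ A, ∀ x, μ x ≠ 0 → x ∈ Set.Ioc (-A) A := by
    obtain ⟨A, hA⟩ := hμc.isCompact.isBounded.subset_ball (0 : ℝ)
    refine ⟨A, fun x hx => ?_⟩
    have := hA (subset_tsupport μ hx)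
    rw [Metric.mem_ball, dist_zero_right, Real.norm_eq_abs, abs_lt] at this
    exact ⟨this.1, this.2.le⟩
  have hInt : ∀ φ : ℝ → ℝ, (∀ x, φ x ≠ 0 → μ x ≠ 0) → ∫ x, φ x = ∫ x in -A..A, φ x :=
    fun φ hφ => (intervalIntegral.integral_eq_integral_of_support_subset
      fun x hx => hA x (hφ x hx)).symm
  set U : ℝ → ℝ := fun x => (Z / M) * ∫ t in -A..x, μ t with hU
  have hUd : ∀ x, HasDerivAt U ((Z / M) * μ x) x := fun x =>
    (intervalIntegral.integral_hasDerivAt_right (hμ.intervalIntegrable _ _)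
      (hμ.stronglyMeasurableAtFilter _ _) hμ.continuousAt).const_mul _
  have hUm : Monotone U := monotone_of_hasDerivAt_nonneg hUd fun x => by
    have := hμ0 x
    positivity
  have hUlow : U (-A) = 0 := by simp [hU]
  have hUhigh : U A = Z := by
    simp only [hU]
    rw [← hInt μ fun _ h => h, ← hMdef]
    field_simp
  have hAnn : -A ≤ A := by
    by_contra! h
    have : ∀ x, μ x = 0 := fun x => by
      by_contra hx
      have := hA x hx
      linarith [this.1, this.2]
    simp [hMdef, this] at hM
  have hmem : ∀ x ∈ Set.Icc (-A) A, e.symm (U x) ∈ Set.Icc (-L) L := by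
    intro x hx
    constructor
    · rw [← heG' (-L), hGL, ← hUlow]
      exact e.symm.monotone (hUm hx.1)
    · rw [← heG' L, hGZ, ← hUhigh]
      exact e.symm.monotone (hUm hx.2)
  have hTd : ∀ x, HasDerivAt (fun x => e.symm (U x)) ((Z / M) * (μ x / ρ (e.symm (U x)))) x := by
    intro x
    have h := (hinv (U x)).comp x (hUd x)
    refine h.congr_deriv ?_
    by_cases hx : μ x = 0
    · simp [hx]
    · rw [hrρ _ (hmem x (Set.Ioc_subset_Icc_self (hA x hx)))]
      ring
  refine ⟨fun x => e.symm (U x), hTd, fun ψ hψ => ?_⟩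
  have hTc : Continuous fun x => e.symm (U x) :=
    continuous_iff_continuousAt.2 fun y => (hTd y).continuousAt
  have hsub := intervalIntegral.integral_comp_mul_deriv (a := -A) (b := A)
    (f := fun x => e.symm (U x)) (g := fun y => ψ y * ρ y)
    (fun x _ => hTd x) (Continuous.continuousOn (by
      exact continuous_const.mul (hμ.div (hρ.comp hTc) fun x => (hρ0 _).ne'))) (hψ.mul hρ)
  have e1 : e.symm (U (-A)) = -L := by rw [hUlow, ← hGL, heG']
  have e2 : e.symm (U A) = L := by rw [hUhigh, ← hGZ, heG']
  simp only [e1, e2] at hsub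
  rw [← hsub, hInt _ fun x hx => left_ne_zero_of_mul hx, ← intervalIntegral.integral_const_mul]
  refine intervalIntegral.integral_congr fun x _ => ?_
  have := hρ0 (e.symm (U x))
  simp only [Function.comp]
  field_simp

/-- Hölder's inequality for three functions, in the form of natural powers. -/
theorem mul_integral_pow_le_of_pow_le {α : Type*} [MeasurableSpace α] {ν : Measure α}
    {u X y h : α → ℝ} {c : ℝ} {p q r : ℕ} (hpqr : 0 < p + q + r) (hc : 0 ≤ c)
    (hu : ∀ t, 0 ≤ u t) (hX : ∀ t, 0 ≤ X t) (hy : ∀ t, 0 ≤ y t) (hh : ∀ t, 0 ≤ h t)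
    (hui : Integrable u ν) (hXi : Integrable X ν) (hyi : Integrable y ν) (hhi : Integrable h ν)
    (hle : ∀ t, c * u t ^ (p + q + r) ≤ X t ^ p * y t ^ q * h t ^ r) :
    c * (∫ t, u t ∂ν) ^ (p + q + r) ≤
      (∫ t, X t ∂ν) ^ p * (∫ t, y t ∂ν) ^ q * (∫ t, h t ∂ν) ^ r := by
  set n := p + q + r with hn
  have hn0 : (n : ℝ) ≠ 0 := by exact_mod_cast hpqr.ne'
  have hne : ∀ m : ℕ, (0 : ℝ) ≤ (m : ℝ) / n := fun m => by positivity
  have hsum : (p : ℝ) / n + q / n + r / n = 1 := by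
    rw [← add_div, ← add_div, div_eq_one_iff_eq hn0, hn]
    push_cast
    ring
  set F : Fin 3 → α → ENNReal := ![fun t => ENNReal.ofReal (X t), fun t => ENNReal.ofReal (y t),
    fun t => ENNReal.ofReal (h t)] with hF
  set P : Fin 3 → ℝ := ![(p : ℝ) / n, (q : ℝ) / n, (r : ℝ) / n] with hP
  have key := ENNReal.lintegral_prod_norm_pow_le (μ := ν) Finset.univ (f := F) (p := P)
    (by
      intro i _
      fin_cases i
      · exact hXi.aemeasurable.ennreal_ofReal
      · exact hyi.aemeasurable.ennreal_ofReal
      · exact hhi.aemeasurable.ennreal_ofReal)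
    (by simpa [hP, Fin.sum_univ_three] using hsum)
    (by
      intro i _
      fin_cases i
      · exact hne p
      · exact hne q
      · exact hne r)
  simp only [Fin.prod_univ_three, hF, hP, Matrix.cons_val_zero, Matrix.cons_val_one,
    Matrix.cons_val] at key
  rw [← ofReal_integral_eq_lintegral_ofReal hXi (.of_forall hX),
    ← ofReal_integral_eq_lintegral_ofReal hyi (.of_forall hy),
    ← ofReal_integral_eq_lintegral_ofReal hhi (.of_forall hh)] at key
  have hIX : 0 ≤ ∫ t, X t ∂ν := integral_nonneg hX
  have hIy : 0 ≤ ∫ t, y t ∂ν := integral_nonneg hy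
  have hIh : 0 ≤ ∫ t, h t ∂ν := integral_nonneg hh
  have hIu : 0 ≤ ∫ t, u t ∂ν := integral_nonneg hu
  have hprod : ∀ A B C : ℝ, 0 ≤ A → 0 ≤ B → 0 ≤ C →
      ENNReal.ofReal A ^ ((p : ℝ) / n) * ENNReal.ofReal B ^ ((q : ℝ) / n) *
        ENNReal.ofReal C ^ ((r : ℝ) / n) =
      ENNReal.ofReal (A ^ ((p : ℝ) / n) * B ^ ((q : ℝ) / n) * C ^ ((r : ℝ) / n)) := by
    intro A B C hA hB hC
    rw [ENNReal.ofReal_rpow_of_nonneg hA (hne p), ENNReal.ofReal_rpow_of_nonneg hB (hne q),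
      ENNReal.ofReal_rpow_of_nonneg hC (hne r), ← ENNReal.ofReal_mul (by positivity),
      ← ENNReal.ofReal_mul (by positivity)]
  have hpow : ∀ A B C : ℝ, 0 ≤ A → 0 ≤ B → 0 ≤ C →
      (A ^ ((p : ℝ) / n) * B ^ ((q : ℝ) / n) * C ^ ((r : ℝ) / n)) ^ n = A ^ p * B ^ q * C ^ r := by
    intro A B C hA hB hC
    have haux : ∀ (D : ℝ) (m : ℕ), 0 ≤ D → (D ^ ((m : ℝ) / n)) ^ n = D ^ m := by
      intro D m hD
      rw [← Real.rpow_natCast (D ^ _), ← Real.rpow_mul hD, div_mul_cancel₀ _ hn0,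
        Real.rpow_natCast]
    rw [mul_pow, mul_pow, haux A p hA, haux B q hB, haux C r hC]
  have hcn : (c ^ ((n : ℝ)⁻¹)) ^ n = c := Real.rpow_inv_natCast_pow hc hpqr.ne'
  simp only [fun t => hprod _ _ _ (hX t) (hy t) (hh t), hprod _ _ _ hIX hIy hIh] at key
  have hlow : ENNReal.ofReal (c ^ ((n : ℝ)⁻¹) * ∫ t, u t ∂ν) ≤
      ∫⁻ t, ENNReal.ofReal
        (X t ^ ((p : ℝ) / n) * y t ^ ((q : ℝ) / n) * h t ^ ((r : ℝ) / n)) ∂ν := by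
    rw [← integral_const_mul, ofReal_integral_eq_lintegral_ofReal (hui.const_mul _)
      (.of_forall fun t => mul_nonneg (by positivity) (hu t))]
    refine lintegral_mono fun t => ENNReal.ofReal_le_ofReal ?_
    have h1 := hX t
    have h2 := hy t
    have h3 := hh t
    refine le_of_pow_le_pow_left₀ hpqr.ne' (by positivity) ?_
    rw [hpow _ _ _ h1 h2 h3, mul_pow, hcn]
    exact hle t
  have hfin := (ENNReal.ofReal_le_ofReal_iff (by positivity)).1 (hlow.trans key)
  have := pow_le_pow_left₀ (by positivity) hfin n
  rwa [hpow _ _ _ hIX hIy hIh, mul_pow, hcn] at this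

/-- The Cauchy-Schwarz inequality for a product of square roots. -/
theorem integral_sq_le_of_sq_le_mul {α : Type*} [MeasurableSpace α] {ν : Measure α}
    {u X y : α → ℝ} (hX : ∀ t, 0 ≤ X t) (hy : ∀ t, 0 ≤ y t)
    (hui : Integrable u ν) (hXi : Integrable X ν) (hyi : Integrable y ν)
    (hle : ∀ t, u t ^ 2 ≤ X t * y t) :
    (∫ t, u t ∂ν) ^ 2 ≤ (∫ t, X t ∂ν) * ∫ t, y t ∂ν := by
  have h := mul_integral_pow_le_of_pow_le (ν := ν) (u := fun t => |u t|) (X := X) (y := y)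
    (h := X) (c := 1) (p := 1) (q := 1) (r := 0) (by norm_num) zero_le_one
    (fun t => abs_nonneg _) hX hy hX hui.abs hXi hyi hXi (fun t => by simpa using hle t)
  simp only [one_mul, pow_one, pow_zero, mul_one, add_zero] at h
  refine le_trans ?_ h
  rw [← sq_abs]
  exact pow_le_pow_left₀ (abs_nonneg _) abs_integral_le_integral_abs 2

/-- The integral of `(1 + y ^ 2) ^ (-s)` over the real line. -/
noncomputable def bracketIntegral (s : ℝ) : ℝ := ∫ y : ℝ, (1 + y ^ 2) ^ (-s)

theorem integrable_one_add_sq_rpow_neg {s : ℝ} (hs : 1 / 2 < s) :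
    Integrable fun y : ℝ => (1 + y ^ 2) ^ (-s) := by
  have h := integrable_rpow_neg_one_add_norm_sq (E := ℝ) (μ := volume) (r := 2 * s)
    (by simp; linarith)
  refine h.congr (.of_forall fun y => ?_)
  simp only [Real.norm_eq_abs, sq_abs]
  congr 1
  ring

theorem bracketIntegral_pos {s : ℝ} (hs : 1 / 2 < s) : 0 < bracketIntegral s := by
  have hpos : ∀ y : ℝ, 0 < (1 + y ^ 2) ^ (-s) := fun y => by positivity
  refine (integral_pos_iff_support_of_nonneg (fun y => (hpos y).le)
    (integrable_one_add_sq_rpow_neg hs)).2 ?_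
  rw [Function.support_eq_univ fun y => (hpos y).ne']
  simp

theorem bracketIntegral_add_one {s : ℝ} (hs : 1 / 2 < s) :
    2 * s * bracketIntegral (s + 1) = (2 * s - 1) * bracketIntegral s := by
  have hderiv : ∀ y : ℝ, HasDerivAt (fun y : ℝ => y * (1 + y ^ 2) ^ (-s))
      ((1 - 2 * s) * (1 + y ^ 2) ^ (-s) + 2 * s * (1 + y ^ 2) ^ (-(s + 1))) y := by
    intro y
    have hb : (0 : ℝ) < 1 + y ^ 2 := by positivity
    have h1 : HasDerivAt (fun y : ℝ => 1 + y ^ 2) (2 * y) y := by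
      simpa using (hasDerivAt_pow 2 y).const_add 1
    have h2 := (hasDerivAt_id y).mul (h1.rpow_const (p := -s) (Or.inl hb.ne'))
    refine h2.congr_deriv ?_
    have e : (1 + y ^ 2) ^ (-s) = (1 + y ^ 2) * (1 + y ^ 2) ^ (-s - 1) := by
      rw [Real.rpow_sub_one hb.ne']
      field_simp
    simp only [id, one_mul, show -(s + 1) = -s - 1 by ring, e]
    ring
  have i1 := integrable_one_add_sq_rpow_neg hs
  have i2 := integrable_one_add_sq_rpow_neg (show 1 / 2 < s + 1 by linarith)
  have hle : ∀ y : ℝ, |y * (1 + y ^ 2) ^ (-s)| ≤ (1 + y ^ 2) ^ (1 / 2 - s) := by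
    intro y
    have hb : (0 : ℝ) < 1 + y ^ 2 := by positivity
    rw [abs_mul, abs_of_pos (Real.rpow_pos_of_pos hb _), sub_eq_add_neg, Real.rpow_add hb]
    refine mul_le_mul_of_nonneg_right ?_ (by positivity)
    rw [← Real.sqrt_eq_rpow]
    exact Real.abs_le_sqrt (by linarith)
  have hlim : ∀ l : Filter ℝ, Filter.Tendsto (fun y : ℝ => 1 + y ^ 2) l Filter.atTop →
      Filter.Tendsto (fun y : ℝ => y * (1 + y ^ 2) ^ (-s)) l (nhds 0) := by
    intro l hl
    refine squeeze_zero_norm (a := fun y : ℝ => (1 + y ^ 2) ^ (1 / 2 - s)) hle ?_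
    rw [show (1 / 2 - s : ℝ) = -(s - 1 / 2) by ring]
    exact (tendsto_rpow_neg_atTop (by linarith)).comp hl
  have h := integral_of_hasDerivAt_of_tendsto hderiv ((i1.const_mul _).add (i2.const_mul _))
    (hlim _ (Filter.tendsto_atTop_add_const_left _ _ (by
      simpa [Function.comp_def] using (Filter.tendsto_pow_atTop (α := ℝ) two_ne_zero).comp
        Filter.tendsto_neg_atBot_atTop)))
    (hlim _ (Filter.tendsto_atTop_add_const_left _ _ (Filter.tendsto_pow_atTop two_ne_zero)))
  rw [integral_add (i1.const_mul _) (i2.const_mul _), integral_const_mul, integral_const_mul] at h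
  simp only [bracketIntegral]
  linarith

theorem continuous_fin_cons_prod (k : ℕ) :
    Continuous fun p : ℝ × (Fin k → ℝ) => (Fin.cons p.1 p.2 : Fin (k + 1) → ℝ) :=
  (Fin.consEquivL ℝ fun _ : Fin (k + 1) => ℝ).continuous

theorem integral_fin_cons {k : ℕ} {g : (Fin (k + 1) → ℝ) → ℝ} (hg : Integrable g) :
    ∫ x, g x = ∫ t : ℝ, ∫ y : Fin k → ℝ, g (Fin.cons t y) := by
  have hmp := (volume_preserving_piFinSuccAbove (fun _ : Fin (k + 1) => ℝ) 0).symm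
  have he : ∀ p : ℝ × (Fin k → ℝ),
      (MeasurableEquiv.piFinSuccAbove (fun _ : Fin (k + 1) => ℝ) 0).symm p = Fin.cons p.1 p.2 := by
    intro p
    simp [MeasurableEquiv.piFinSuccAbove, Fin.consEquiv]
  rw [← hmp.integral_comp (MeasurableEquiv.measurableEmbedding _) g, Measure.volume_eq_prod,
    integral_prod]
  · simp only [he]
  · exact (hmp.integrable_comp_emb (MeasurableEquiv.measurableEmbedding _)).2 hg

theorem HasCompactSupport.fin_cons {k : ℕ} {V : Type*} [Zero V] {g : (Fin (k + 1) → ℝ) → V}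
    (hg : HasCompactSupport g) (t : ℝ) :
    HasCompactSupport fun y : Fin k → ℝ => g (Fin.cons t y) := by
  refine HasCompactSupport.intro (hg.isCompact.image (f := fun x (j : Fin k) => x j.succ)
    (by fun_prop)) fun y hy => ?_
  by_contra h
  exact hy ⟨Fin.cons t y, subset_tsupport g h, by ext j; simp⟩

theorem HasCompactSupport.integral_fin_cons {k : ℕ} {g : (Fin (k + 1) → ℝ) → ℝ}
    (hg : HasCompactSupport g) :
    HasCompactSupport fun t : ℝ => ∫ y : Fin k → ℝ, g (Fin.cons t y) := by
  refine HasCompactSupport.intro (hg.isCompact.image (f := fun x => x 0) (by fun_prop))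
    fun t ht => ?_
  have : ∀ y : Fin k → ℝ, g (Fin.cons t y) = 0 := fun y => by
    by_contra h
    exact ht ⟨Fin.cons t y, subset_tsupport g h, by simp⟩
  simp [this]

theorem Continuous.integral_fin_cons {k : ℕ} {g : (Fin (k + 1) → ℝ) → ℝ} (hgc : Continuous g)
    (hg : HasCompactSupport g) :
    Continuous fun t : ℝ => ∫ y : Fin k → ℝ, g (Fin.cons t y) := by
  rw [← continuousOn_univ]
  refine continuousOn_integral_of_compact_support
    (hg.isCompact.image (f := fun x (j : Fin k) => x j.succ) (by fun_prop)) ?_ ?_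
  · exact (hgc.comp (continuous_fin_cons_prod k)).continuousOn
  · intro t y _ hy
    by_contra h
    exact hy ⟨Fin.cons t y, subset_tsupport g h, by ext j; simp⟩

theorem succ_pow_mul_pow_mul_le (k : ℕ) {X E : ℝ} (hX : 0 ≤ X) (hE : 0 ≤ E) :
    ((k : ℝ) + 1) ^ (k + 1) * (X ^ k * E) ≤ (k : ℝ) ^ k * (X + E) ^ (k + 1) := by
  rcases Nat.eq_zero_or_pos k with rfl | hk
  · simpa using hX
  have hk' : (0 : ℝ) < k := by exact_mod_cast hk
  have h := Real.geom_mean_le_arith_mean2_weighted (w₁ := k / (k + 1)) (w₂ := 1 / (k + 1))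
    (p₁ := X / k) (p₂ := E) (by positivity) (by positivity) (by positivity) hE (by field_simp)
  have h2 := pow_le_pow_left₀ (by positivity) h (k + 1)
  have e1 : ((X / k) ^ ((k : ℝ) / (k + 1))) ^ (k + 1) = (X / k) ^ k := by
    rw [← Real.rpow_natCast (_ ^ _), ← Real.rpow_mul (by positivity), ← Real.rpow_natCast]
    congr 1
    push_cast
    field_simp
  have e2 : (E ^ ((1 : ℝ) / (k + 1))) ^ (k + 1) = E := by
    rw [← Real.rpow_natCast (_ ^ _), ← Real.rpow_mul (by positivity)]
    push_cast
    rw [one_div_mul_cancel (by positivity), Real.rpow_one]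
  have e3 : (k : ℝ) / (k + 1) * (X / k) + 1 / (k + 1) * E = (X + E) / (k + 1) := by
    field_simp
  rw [mul_pow, e1, e2, e3, div_pow, div_pow, le_div_iff₀ (by positivity)] at h2
  calc ((k : ℝ) + 1) ^ (k + 1) * (X ^ k * E)
      = (k : ℝ) ^ k * (X ^ k / k ^ k * E * (k + 1) ^ (k + 1)) := by field_simp
    _ ≤ _ := by gcongr

theorem abs_fderiv_norm_rpow_apply_le {V F : Type*} [NormedAddCommGroup V] [NormedSpace ℝ V]
    [NormedAddCommGroup F] [InnerProductSpace ℝ F] {f : V → F} (hf : Differentiable ℝ f)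
    {r : ℝ} (hr : 1 < r) (x v : V) :
    |fderiv ℝ (fun x => ‖f x‖ ^ r) x v| ≤ r * ‖f x‖ ^ (r - 1) * ‖fderiv ℝ f x v‖ := by
  rw [hf.fderiv_norm_rpow hr]
  simp only [smul_apply, ContinuousLinearMap.comp_apply, innerSL_apply_apply,
    smul_eq_mul]
  rw [abs_mul, abs_of_nonneg (by positivity)]
  calc r * ‖f x‖ ^ (r - 2) * |inner ℝ (f x) (fderiv ℝ f x v)|
      ≤ r * ‖f x‖ ^ (r - 2) * (‖f x‖ * ‖fderiv ℝ f x v‖) := by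
        gcongr
        exact abs_real_inner_le_norm _ _
    _ = r * (‖f x‖ ^ (r - 2) * ‖f x‖) * ‖fderiv ℝ f x v‖ := by ring
    _ = _ := by
        rw [← Real.rpow_add_one' (norm_nonneg _) (by linarith)]
        ring_nf

theorem integral_slice_le_truncated {k j : ℕ} {f : (Fin (k + 1) → ℝ) → ℂ} (hf : ContDiff ℝ 1 f)
    (hfc : HasCompactSupport f) {p r c L : ℝ} (hr : 1 < r) (hpr : p = 2 * (r - 1)) (hc : 0 ≤ c)
    (hL : 0 < L) {n : ℕ} (hn : n = k + 2 + 2 * j) {M H E XX B Z : ℝ}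
    (hMdef : M = ∫ x, ‖f x‖ ^ p) (hHdef : H = ∫ x, ‖f x‖ ^ r)
    (hEdef : E = ∫ x, ‖fderiv ℝ f x (Pi.single 0 1)‖ ^ 2)
    (hXXdef : XX = ∫ x, ∑ i : Fin k, ‖fderiv ℝ f x (Pi.single i.succ 1)‖ ^ 2)
    (hBdef : B = ∫ y in -L..L, (1 + y ^ 2) ^ (1 - (n : ℝ) / 2))
    (hZdef : Z = ∫ y in -L..L, (1 + y ^ 2) ^ (-((n : ℝ) / 2))) (hM : 0 < M)
    (hslice : ∀ t : ℝ, c * (∫ y : Fin k → ℝ, ‖f (Fin.cons t y)‖ ^ p) ^ (k + 2 * j) ≤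
      (∫ y : Fin k → ℝ, ∑ i : Fin k, ‖fderiv ℝ f (Fin.cons t y) (Pi.single i.succ 1)‖ ^ 2) ^ k *
        (∫ y : Fin k → ℝ, ‖f (Fin.cons t y)‖ ^ r) ^ (2 * j + 2)) :
    c * M ^ n * B ^ n * Z ^ 3 ≤
      XX ^ k * E * H ^ (2 * j) * r ^ 2 * (B - Z) * M ^ 3 * Z ^ n := by
  have hp : 0 < p := by linarith
  set ρ : ℝ → ℝ := fun y => (1 + y ^ 2) ^ (-((n : ℝ) / 2)) with hρdef
  have hb : ∀ y : ℝ, (0 : ℝ) < 1 + y ^ 2 := fun y => by positivity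
  have hρ : Continuous ρ :=
    (show Continuous fun y : ℝ => 1 + y ^ 2 by fun_prop).rpow_const fun y => Or.inl (hb y).ne'
  have hρ0 : ∀ y, 0 < ρ y := fun y => Real.rpow_pos_of_pos (hb y) _
  have hρmul : ∀ y, (1 + y ^ 2) ^ (1 - (n : ℝ) / 2) = (1 + y ^ 2) * ρ y := fun y => by
    rw [hρdef, sub_eq_add_neg, Real.rpow_add (hb y), Real.rpow_one]
  have hρpow : ∀ y, (1 + y ^ 2) ^ n * ρ y ^ 2 = 1 := fun y => by
    rw [hρdef, ← Real.rpow_natCast (_ ^ _), ← Real.rpow_mul (hb y).le, ← Real.rpow_natCast,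
      ← Real.rpow_add (hb y)]
    push_cast
    rw [show (n : ℝ) + -(n / 2) * 2 = 0 by ring, Real.rpow_zero]
  -- continuity and supports
  have hdf : Differentiable ℝ f := hf.differentiable one_ne_zero
  have hnp : ∀ s : ℝ, 0 < s → Continuous fun x => ‖f x‖ ^ s := fun s hs =>
    hf.continuous.norm.rpow_const fun _ => Or.inr hs.le
  have hnpc : ∀ s : ℝ, 0 < s → HasCompactSupport fun x => ‖f x‖ ^ s := fun s hs =>
    hfc.comp_left (g := fun z => ‖z‖ ^ s) (by simp [hs.ne'])
  have hdc : ∀ v, Continuous fun x => fderiv ℝ f x v := fun v =>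
    (hf.continuous_fderiv one_ne_zero).clm_apply continuous_const
  have hdcs : ∀ v, HasCompactSupport fun x => fderiv ℝ f x v := fun v =>
    hfc.fderiv_apply (𝕜 := ℝ) v
  have hEc : Continuous fun x => ‖fderiv ℝ f x (Pi.single 0 1)‖ ^ 2 := (hdc _).norm.pow 2
  have hEcs : HasCompactSupport fun x => ‖fderiv ℝ f x (Pi.single 0 1)‖ ^ 2 :=
    (hdcs _).comp_left (g := fun z => ‖z‖ ^ 2) (by simp)
  have hXc : Continuous fun x => ∑ i : Fin k, ‖fderiv ℝ f x (Pi.single i.succ 1)‖ ^ 2 :=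
    continuous_finsetSum _ fun i _ => (hdc _).norm.pow 2
  have hXcs : HasCompactSupport fun x =>
      ∑ i : Fin k, ‖fderiv ℝ f x (Pi.single i.succ 1)‖ ^ 2 :=
    (hfc.fderiv ℝ).comp_left
      (g := fun A : (Fin (k + 1) → ℝ) →L[ℝ] ℂ =>
        ∑ i : Fin k, ‖A (Pi.single i.succ 1)‖ ^ 2) (by simp)
  have hInt : ∀ g : (Fin (k + 1) → ℝ) → ℝ, Continuous g → HasCompactSupport g → Integrable g :=
    fun g h1 h2 => h1.integrable_of_hasCompactSupport h2
  -- slices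
  set μ : ℝ → ℝ := fun t => ∫ y : Fin k → ℝ, ‖f (Fin.cons t y)‖ ^ p with hμdef
  set h : ℝ → ℝ := fun t => ∫ y : Fin k → ℝ, ‖f (Fin.cons t y)‖ ^ r with hhdef
  set X : ℝ → ℝ := fun t => ∫ y : Fin k → ℝ,
    ∑ i : Fin k, ‖fderiv ℝ f (Fin.cons t y) (Pi.single i.succ 1)‖ ^ 2 with hXdef
  have hr0 : 0 < r := by linarith
  have hμc : Continuous μ := (hnp p hp).integral_fin_cons (hnpc p hp)
  have hμcs : HasCompactSupport μ := (hnpc p hp).integral_fin_cons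
  have hμ0 : ∀ t, 0 ≤ μ t := fun t => integral_nonneg fun y => by positivity
  have hhc : Continuous h := (hnp r hr0).integral_fin_cons (hnpc r hr0)
  have hhcs : HasCompactSupport h := (hnpc r hr0).integral_fin_cons
  have hh0 : ∀ t, 0 ≤ h t := fun t => integral_nonneg fun y => by positivity
  have hX0 : ∀ t, 0 ≤ X t := fun t => integral_nonneg fun y => by positivity
  have hXi : Integrable X :=
    (hXc.integral_fin_cons hXcs).integrable_of_hasCompactSupport hXcs.integral_fin_cons
  have hMμ : M = ∫ t, μ t := hMdef.trans <| integral_fin_cons (hInt _ (hnp p hp) (hnpc p hp))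
  have hHh : H = ∫ t, h t := hHdef.trans <| integral_fin_cons (hInt _ (hnp r hr0) (hnpc r hr0))
  have hXX : XX = ∫ t, X t := hXXdef.trans <|
    integral_fin_cons (hInt _ hXc hXcs)
  obtain ⟨T, hTd, hTint⟩ := exists_monotone_transport hρ hρ0 hμc hμ0 hμcs (hMμ ▸ hM) hL
  change Z = ∫ y in -L..L, ρ y at hZdef
  rw [← hMμ, ← hZdef] at hTd hTint
  have hZ : 0 < Z := hZdef ▸ intervalIntegral.intervalIntegral_pos_of_pos
    (hρ.intervalIntegrable _ _) hρ0 (by linarith)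
  have hTc : Continuous T := continuous_iff_continuousAt.2 fun y => (hTd y).continuousAt
  set τ : ℝ → ℝ := fun t => Z / M * (μ t / ρ (T t)) with hτdef
  have hτc : Continuous τ :=
    continuous_const.mul (hμc.div (hρ.comp hTc) fun x => (hρ0 _).ne')
  have hτ0 : ∀ t, 0 ≤ τ t := fun t => by
    have := hμ0 t
    have := hρ0 (T t)
    positivity
  have hB1 : ∫ t, μ t * (1 + T t ^ 2) = M / Z * B := by
    rw [hTint (fun y => 1 + y ^ 2) (by fun_prop), hBdef]
    simp only [hρmul]
  have hB2 : ∫ t, μ t * T t ^ 2 = M / Z * (B - Z) := by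
    rw [hTint (fun y => y ^ 2) (by fun_prop), hBdef, hZdef,
      ← intervalIntegral.integral_sub]
    · simp only [hρmul]
      congr 2
      ext y
      ring
    · simp only [hρmul]
      exact Continuous.intervalIntegrable (by fun_prop) _ _
    · exact hρ.intervalIntegrable _ _
  -- integration by parts
  have hg1 : ContDiff ℝ 1 fun x => ‖f x‖ ^ r := hf.norm_rpow hr
  have hTx : ∀ x : Fin (k + 1) → ℝ, HasFDerivAt (fun x : Fin (k + 1) → ℝ => T (x 0))
      (τ (x 0) • ContinuousLinearMap.proj (R := ℝ) (φ := fun _ : Fin (k + 1) => ℝ) 0) x := by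
    intro x
    exact (hTd (x 0)).comp_hasFDerivAt x (ContinuousLinearMap.proj (R := ℝ)
      (φ := fun _ : Fin (k + 1) => ℝ) 0).hasFDerivAt
  have hTx' : ∀ x : Fin (k + 1) → ℝ,
      fderiv ℝ (fun x : Fin (k + 1) → ℝ => T (x 0)) x (Pi.single 0 1) = τ (x 0) := by
    intro x
    rw [(hTx x).fderiv]
    simp
  have hT0 : Continuous fun x : Fin (k + 1) → ℝ => T (x 0) := hTc.comp (continuous_apply 0)
  have hτ0c : Continuous fun x : Fin (k + 1) → ℝ => τ (x 0) := hτc.comp (continuous_apply 0)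
  have hgd : Continuous fun x => fderiv ℝ (fun x => ‖f x‖ ^ r) x (Pi.single 0 1) :=
    (hg1.continuous_fderiv one_ne_zero).clm_apply continuous_const
  have hgdT : Integrable fun x => fderiv ℝ (fun x => ‖f x‖ ^ r) x (Pi.single 0 1) * T (x 0) :=
    hInt _ (hgd.mul hT0) (((hnpc r hr0).fderiv_apply (𝕜 := ℝ) _).mul_right)
  have hgτ : Integrable fun x => ‖f x‖ ^ r * τ (x 0) :=
    hInt _ ((hnp r hr0).mul hτ0c) (hnpc r hr0).mul_right
  have hY : ∫ t, h t * τ t =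
      -∫ x, fderiv ℝ (fun x => ‖f x‖ ^ r) x (Pi.single 0 1) * T (x 0) := by
    rw [← integral_mul_fderiv_eq_neg_fderiv_mul_of_integrable hgdT
      (by simpa only [hTx'] using hgτ)
      (hInt _ ((hnp r hr0).mul hT0) (hnpc r hr0).mul_right)
      (fun x _ => (hg1.differentiable one_ne_zero) x) (fun x _ => (hTx x).differentiableAt)]
    simp only [hTx']
    rw [integral_fin_cons hgτ]
    simp only [Fin.cons_zero, integral_mul_const, hhdef]
  have hpT : Integrable fun x => ‖f x‖ ^ p * T (x 0) ^ 2 :=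
    hInt _ ((hnp p hp).mul (hT0.pow 2)) (hnpc p hp).mul_right
  have hY2 : (∫ t, h t * τ t) ^ 2 ≤ E * (r ^ 2 * (M / Z * (B - Z))) := by
    have e : r ^ 2 * (M / Z * (B - Z)) = ∫ x, r ^ 2 * (‖f x‖ ^ p * T (x 0) ^ 2) := by
      rw [integral_const_mul, integral_fin_cons hpT, ← hB2]
      simp only [Fin.cons_zero, integral_mul_const, hμdef]
    rw [hY, neg_sq, e, hEdef]
    refine integral_sq_le_of_sq_le_mul (fun x => by positivity) (fun x => by positivity) hgdT
      (hInt _ hEc hEcs) (hpT.const_mul _) fun x => ?_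
    have h1 := abs_fderiv_norm_rpow_apply_le hdf hr x (Pi.single 0 1)
    have h2 := pow_le_pow_left₀ (abs_nonneg _) h1 2
    rw [sq_abs, mul_pow, mul_pow] at h2
    have h3 : (‖f x‖ ^ (r - 1)) ^ 2 = ‖f x‖ ^ p := by
      rw [← Real.rpow_natCast (_ ^ _), ← Real.rpow_mul (norm_nonneg _), hpr]
      congr 1
      push_cast
      ring
    rw [h3] at h2
    calc _ = (fderiv ℝ (fun x => ‖f x‖ ^ r) x (Pi.single 0 1)) ^ 2 * T (x 0) ^ 2 := by ring
      _ ≤ (r ^ 2 * ‖f x‖ ^ p * ‖fderiv ℝ f x (Pi.single 0 1)‖ ^ 2) * T (x 0) ^ 2 := by gcongr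
      _ = _ := by ring
  -- Hölder
  have hhold := mul_integral_pow_le_of_pow_le (ν := volume) (u := fun t => μ t * (1 + T t ^ 2))
    (X := X) (y := fun t => h t * τ t) (h := h) (c := c * (Z / M) ^ 2) (p := k) (q := 2)
    (r := 2 * j) (by omega) (by positivity)
    (fun t => mul_nonneg (hμ0 t) (by positivity)) hX0 (fun t => mul_nonneg (hh0 t) (hτ0 t)) hh0
    ((hμc.mul (by fun_prop)).integrable_of_hasCompactSupport hμcs.mul_right) hXi
    ((hhc.mul hτc).integrable_of_hasCompactSupport hhcs.mul_right)
    (hhc.integrable_of_hasCompactSupport hhcs)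
    (by
      intro t
      have hs := hslice t
      have hq := hρpow (T t)
      have hq0 := (hρ0 (T t)).ne'
      rw [← hn]
      calc c * (Z / M) ^ 2 * (μ t * (1 + T t ^ 2)) ^ n
          = (c * μ t ^ (k + 2 * j)) * ((Z / M) * (μ t / ρ (T t))) ^ 2 *
              ((1 + T t ^ 2) ^ n * ρ (T t) ^ 2) := by
            rw [mul_pow (μ t), show μ t ^ n = μ t ^ (k + 2 * j) * μ t ^ 2 by
              rw [← pow_add]; congr 1; omega]
            field_simp
        _ = (c * μ t ^ (k + 2 * j)) * τ t ^ 2 := by rw [hq, mul_one]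
        _ ≤ (X t ^ k * h t ^ (2 * j + 2)) * τ t ^ 2 := by gcongr
        _ = _ := by ring)
  rw [← hn, hB1, ← hHh, ← hXX] at hhold
  have hXX0 : 0 ≤ XX := hXXdef ▸ integral_nonneg fun y => by positivity
  have hH0 : 0 ≤ H := hHdef ▸ integral_nonneg fun y => by positivity
  have hfin : c * (Z / M) ^ 2 * (M / Z * B) ^ n ≤
      XX ^ k * (E * (r ^ 2 * (M / Z * (B - Z)))) * H ^ (2 * j) :=
    hhold.trans (by gcongr)
  calc c * M ^ n * B ^ n * Z ^ 3
      = (c * (Z / M) ^ 2 * (M / Z * B) ^ n) * (M ^ 2 * Z * Z ^ n) := by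
        rw [mul_pow, div_pow, div_pow]
        field_simp
    _ ≤ (XX ^ k * (E * (r ^ 2 * (M / Z * (B - Z)))) * H ^ (2 * j)) * (M ^ 2 * Z * Z ^ n) := by
        gcongr
    _ = _ := by field_simp

theorem hasFDerivAt_fin_cons {k : ℕ} (t : ℝ) (y : Fin k → ℝ) :
    HasFDerivAt (fun y : Fin k → ℝ => (Fin.cons t y : Fin (k + 1) → ℝ))
      ((Fin.consEquivL ℝ fun _ : Fin (k + 1) => ℝ : ℝ × (Fin k → ℝ) →L[ℝ] (Fin (k + 1) → ℝ)).comp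
        (ContinuousLinearMap.inr ℝ ℝ (Fin k → ℝ))) y :=
  ((Fin.consEquivL ℝ fun _ : Fin (k + 1) => ℝ).hasFDerivAt (x := (t, y))).comp y
    (hasFDerivAt_prodMk_right t y)

theorem contDiff_fin_cons {k : ℕ} (t : ℝ) :
    ContDiff ℝ 1 fun y : Fin k → ℝ => (Fin.cons t y : Fin (k + 1) → ℝ) :=
  ((Fin.consEquivL ℝ fun _ : Fin (k + 1) => ℝ).contDiff).comp (contDiff_prodMk_right t)

theorem fderiv_comp_fin_cons_single {k : ℕ} {f : (Fin (k + 1) → ℝ) → ℂ} (hf : ContDiff ℝ 1 f)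
    (t : ℝ) (y : Fin k → ℝ) (i : Fin k) :
    fderiv ℝ (fun y : Fin k → ℝ => f (Fin.cons t y)) y (Pi.single i 1) =
      fderiv ℝ f (Fin.cons t y) (Pi.single i.succ 1) := by
  have h := ((hf.differentiable one_ne_zero (Fin.cons t y)).hasFDerivAt).comp y
    (hasFDerivAt_fin_cons t y)
  have h' := h.fderiv
  rw [Function.comp_def] at h'
  rw [h']
  simp only [ContinuousLinearMap.comp_apply, ContinuousLinearMap.inr_apply]
  congr 1
  change (Fin.cons (0 : ℝ) (Pi.single i (1 : ℝ) : Fin k → ℝ) : Fin (k + 1) → ℝ) = _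
  ext l
  refine Fin.cases ?_ (fun l => ?_) l
  · simp [(Fin.succ_ne_zero i).symm]
  · simp [Pi.single_apply]

theorem integral_slice_le {k j : ℕ} {f : (Fin (k + 1) → ℝ) → ℂ} (hf : ContDiff ℝ 1 f)
    (hfc : HasCompactSupport f) {p r c : ℝ} (hr : 1 < r) (hpr : p = 2 * (r - 1)) (hc : 0 ≤ c)
    {n : ℕ} (hn : n = k + 2 + 2 * j) (hn4 : 4 ≤ n) {M H E XX : ℝ}
    (hMdef : M = ∫ x, ‖f x‖ ^ p) (hHdef : H = ∫ x, ‖f x‖ ^ r)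
    (hEdef : E = ∫ x, ‖fderiv ℝ f x (Pi.single 0 1)‖ ^ 2)
    (hXXdef : XX = ∫ x, ∑ i : Fin k, ‖fderiv ℝ f x (Pi.single i.succ 1)‖ ^ 2) (hM : 0 < M)
    (hslice : ∀ t : ℝ, c * (∫ y : Fin k → ℝ, ‖f (Fin.cons t y)‖ ^ p) ^ (k + 2 * j) ≤
      (∫ y : Fin k → ℝ, ∑ i : Fin k, ‖fderiv ℝ f (Fin.cons t y) (Pi.single i.succ 1)‖ ^ 2) ^ k *
        (∫ y : Fin k → ℝ, ‖f (Fin.cons t y)‖ ^ r) ^ (2 * j + 2)) :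
    c * M ^ (n - 3) * (((n : ℝ) - 2) ^ n / ((n : ℝ) - 3) ^ (n - 1)) *
        bracketIntegral ((n : ℝ) / 2) ^ 2 ≤ XX ^ k * E * H ^ (2 * j) * r ^ 2 := by
  have hn4' : (4 : ℝ) ≤ n := by exact_mod_cast hn4
  set Z := bracketIntegral ((n : ℝ) / 2) with hZ
  set B := bracketIntegral ((n : ℝ) / 2 - 1) with hB
  have hZ0 : 0 < Z := bracketIntegral_pos (by linarith)
  have htend : ∀ s : ℝ, 1 / 2 < s → Filter.Tendsto
      (fun L : ℝ => ∫ y in -L..L, ((1 : ℝ) + y ^ 2) ^ (-s)) Filter.atTop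
      (nhds (bracketIntegral s)) := fun s hs =>
    intervalIntegral_tendsto_integral (integrable_one_add_sq_rpow_neg hs)
      Filter.tendsto_neg_atTop_atBot Filter.tendsto_id
  have hZt := htend ((n : ℝ) / 2) (by linarith)
  have hBt := htend ((n : ℝ) / 2 - 1) (by linarith)
  rw [← hZ] at hZt
  rw [← hB] at hBt
  have hlim : c * M ^ n * B ^ n * Z ^ 3 ≤
      XX ^ k * E * H ^ (2 * j) * r ^ 2 * (B - Z) * M ^ 3 * Z ^ n := by
    refine le_of_tendsto_of_tendsto (((hBt.pow n).const_mul (c * M ^ n)).mul (hZt.pow 3))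
      ((((hBt.sub hZt).const_mul (XX ^ k * E * H ^ (2 * j) * r ^ 2)).mul_const (M ^ 3)).mul
        (hZt.pow n)) ?_
    filter_upwards [Filter.eventually_gt_atTop 0] with L hL
    exact integral_slice_le_truncated hf hfc hr hpr hc hL hn hMdef hHdef hEdef hXXdef
      (by congr 1; ext y; congr 1; ring) rfl hM hslice
  have hrec := bracketIntegral_add_one (s := (n : ℝ) / 2 - 1) (by linarith)
  rw [show (n : ℝ) / 2 - 1 + 1 = n / 2 by ring, ← hZ, ← hB] at hrec
  have h3 : (0 : ℝ) < (n : ℝ) - 3 := by linarith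
  have hBZ : B = Z * (((n : ℝ) - 2) / ((n : ℝ) - 3)) := by
    field_simp
    linarith
  have hBZ' : B - Z = Z / ((n : ℝ) - 3) := by
    rw [hBZ]
    field_simp
    ring
  rw [hBZ', hBZ] at hlim
  obtain ⟨m, rfl⟩ : ∃ m, n = m + 3 := ⟨n - 3, by omega⟩
  simp only [Nat.add_sub_cancel, show m + 3 - 1 = m + 2 by omega]
  set q := ((m + 3 : ℕ) : ℝ) with hq
  refine le_of_mul_le_mul_right ?_ (show 0 < Z ^ (m + 3) * Z * M ^ 3 / (q - 3) by positivity)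
  calc _ = c * M ^ (m + 3) * (Z * ((q - 2) / (q - 3))) ^ (m + 3) * Z ^ 3 := by
        rw [mul_pow, div_pow]
        field_simp
        ring
    _ ≤ _ := hlim
    _ = _ := by
        field_simp

theorem integral_sum_fin_succ {α : Type*} [MeasurableSpace α] {ν : Measure α} {k : ℕ}
    {u : Fin (k + 1) → α → ℝ} (hu : ∀ i, Integrable (u i) ν) :
    ∫ x, ∑ i, u i x ∂ν = ∫ x, ∑ i : Fin k, u i.succ x ∂ν + ∫ x, u 0 x ∂ν := by
  simp only [Fin.sum_univ_succ]
  rw [integral_add (hu 0) (integrable_finsetSum _ fun i _ => hu i.succ), add_comm]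

theorem integrable_norm_fderiv_apply_sq {V : Type*} [NormedAddCommGroup V] [NormedSpace ℝ V]
    [MeasurableSpace V] [BorelSpace V] {ν : Measure V} [IsFiniteMeasureOnCompacts ν] {f : V → ℂ}
    (hf : ContDiff ℝ 1 f) (hfc : HasCompactSupport f) (v : V) :
    Integrable (fun x => ‖fderiv ℝ f x v‖ ^ 2) ν := by
  have h1 : Continuous fun x => fderiv ℝ f x v :=
    (hf.continuous_fderiv one_ne_zero).clm_apply continuous_const
  refine (h1.norm.pow 2).integrable_of_hasCompactSupport ?_
  refine HasCompactSupport.intro' (K := tsupport f) hfc (isClosed_tsupport f) fun x hx => ?_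
  have h2 : fderiv ℝ f x = 0 := by
    by_contra h
    exact hx (support_fderiv_subset ℝ h)
  simp [h2]

/-- The constants in the sharp Gagliardo-Nirenberg inequalities that interpolate between the
trivial zero-dimensional one and the Sobolev inequality in dimension `N`. -/
noncomputable def sharpGNConst (N : ℕ) : ℕ → ℝ
  | 0 => 1
  | k + 1 => sharpGNConst N k * (((k : ℝ) + 1) ^ (k + 1) / (k : ℝ) ^ k *
      ((2 * (N : ℝ) - k - 2) ^ (2 * N - k) / (2 * (N : ℝ) - k - 3) ^ (2 * N - k - 1)) *
      bracketIntegral ((2 * (N : ℝ) - k) / 2) ^ 2 / (2 * ((N : ℝ) - 1) / ((N : ℝ) - 2)) ^ 2)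

theorem sharpGNConst_nonneg {N : ℕ} (hN : 3 ≤ N) : ∀ k ≤ N, 0 ≤ sharpGNConst N k
  | 0, _ => zero_le_one
  | k + 1, hk => by
    have ih := sharpGNConst_nonneg hN k (by omega)
    have h1 : (k : ℝ) + 1 ≤ N := by exact_mod_cast hk
    have h2 : (3 : ℝ) ≤ N := by exact_mod_cast hN
    have h3 : (0 : ℝ) ≤ 2 * (N : ℝ) - k - 2 := by linarith
    have h4 : (0 : ℝ) ≤ 2 * (N : ℝ) - k - 3 := by linarith
    rw [sharpGNConst]
    positivity

theorem sharp_gagliardo_nirenberg {N : ℕ} (hN : 3 ≤ N) : ∀ (k j : ℕ), k + j = N →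
    ∀ f : (Fin k → ℝ) → ℂ, ContDiff ℝ 1 f → HasCompactSupport f →
      sharpGNConst N k * (∫ x, ‖f x‖ ^ (2 * (N : ℝ) / ((N : ℝ) - 2))) ^ (N - 2 + j) ≤
        (∫ x, ∑ i, ‖fderiv ℝ f x (Pi.single i 1)‖ ^ 2) ^ k *
          (∫ x, ‖f x‖ ^ (2 * ((N : ℝ) - 1) / ((N : ℝ) - 2))) ^ (2 * j) := by
  have hN' : (3 : ℝ) ≤ N := by exact_mod_cast hN
  have hN2 : (0 : ℝ) < (N : ℝ) - 2 := by linarith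
  intro k
  induction k with
  | zero =>
    intro j hj f hf hfc
    obtain rfl : j = N := by omega
    have hv : ∀ g : (Fin 0 → ℝ) → ℝ, ∫ x, g x = g default := fun g => by
      rw [volume_pi, Measure.pi_of_empty _ default, integral_dirac]
    simp only [hv, sharpGNConst, pow_zero, one_mul]
    refine le_of_eq ?_
    rw [← Real.rpow_natCast (_ ^ _), ← Real.rpow_natCast (_ ^ _), ← Real.rpow_mul (norm_nonneg _),
      ← Real.rpow_mul (norm_nonneg _)]
    congr 1
    have : ((j - 2 : ℕ) : ℝ) = (j : ℝ) - 2 := by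
      rw [Nat.cast_sub (by omega)]
      norm_num
    push_cast
    rw [this]
    field_simp
    ring
  | succ k ih =>
    intro j hj f hf hfc
    set p := 2 * (N : ℝ) / ((N : ℝ) - 2) with hp
    set r := 2 * ((N : ℝ) - 1) / ((N : ℝ) - 2) with hr
    have hr1 : 1 < r := by
      rw [hr, lt_div_iff₀ hN2]
      linarith
    have hpr : p = 2 * (r - 1) := by
      rw [hp, hr]
      field_simp
      ring
    set M := ∫ x, ‖f x‖ ^ p with hM
    set H := ∫ x, ‖f x‖ ^ r with hH
    have hH0 : 0 ≤ H := integral_nonneg fun x => by positivity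
    have hD0 : 0 ≤ ∫ x, ∑ i, ‖fderiv ℝ f x (Pi.single i 1)‖ ^ 2 :=
      integral_nonneg fun x => by positivity
    have hM0 : 0 ≤ M := integral_nonneg fun x => by positivity
    rcases hM0.eq_or_lt with hM0 | hM0
    · rw [← hM0, zero_pow (by omega), mul_zero]
      positivity
    set E := ∫ x, ‖fderiv ℝ f x (Pi.single 0 1)‖ ^ 2 with hE
    set XX := ∫ x, ∑ i : Fin k, ‖fderiv ℝ f x (Pi.single i.succ 1)‖ ^ 2 with hXX
    have hE0 : 0 ≤ E := integral_nonneg fun x => by positivity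
    have hXX0 : 0 ≤ XX := integral_nonneg fun x => by positivity
    have hInt := fun v => integrable_norm_fderiv_apply_sq (ν := volume) hf hfc v
    have hD : ∫ x, ∑ i, ‖fderiv ℝ f x (Pi.single i 1)‖ ^ 2 = XX + E :=
      integral_sum_fin_succ fun i => hInt (Pi.single i 1)
    have hc := sharpGNConst_nonneg hN k (by omega)
    have hslice := integral_slice_le (j := j) hf hfc hr1 hpr hc (n := 2 * N - k) (by omega)
      (by omega) hM hH hE hXX hM0 fun t => by
        have := ih (j + 1) (by omega) (fun y => f (Fin.cons t y)) (hf.comp (contDiff_fin_cons t))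
          (hfc.fin_cons t)
        simp only [fderiv_comp_fin_cons_single hf] at this
        rw [show N - 2 + (j + 1) = k + 2 * j by omega, show 2 * (j + 1) = 2 * j + 2 by ring] at this
        exact this
    have hcast : ((2 * N - k : ℕ) : ℝ) = 2 * (N : ℝ) - k := by
      rw [Nat.cast_sub (by omega)]
      push_cast
      ring
    rw [hcast, show 2 * N - k - 3 = N - 2 + j by omega] at hslice
    have hamgm := succ_pow_mul_pow_mul_le k hXX0 hE0
    rw [hD, sharpGNConst, ← hr]
    have hkk : (0 : ℝ) < (k : ℝ) ^ k := by
      rcases Nat.eq_zero_or_pos k with rfl | hk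
      · simp
      · positivity
    have hr0 : 0 < r := by linarith
    set A := (2 * (N : ℝ) - k - 2) ^ (2 * N - k) / (2 * (N : ℝ) - k - 3) ^ (2 * N - k - 1)
    set I := bracketIntegral ((2 * (N : ℝ) - k) / 2)
    calc _ = (sharpGNConst N k * M ^ (N - 2 + j) * A * I ^ 2) *
          (((k : ℝ) + 1) ^ (k + 1) / (k : ℝ) ^ k / r ^ 2) := by ring
      _ ≤ (XX ^ k * E * H ^ (2 * j) * r ^ 2) *
          (((k : ℝ) + 1) ^ (k + 1) / (k : ℝ) ^ k / r ^ 2) := by gcongr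
      _ = (((k : ℝ) + 1) ^ (k + 1) * (XX ^ k * E)) * (H ^ (2 * j) / (k : ℝ) ^ k) := by
        field_simp
      _ ≤ ((k : ℝ) ^ k * (XX + E) ^ (k + 1)) * (H ^ (2 * j) / (k : ℝ) ^ k) := by gcongr
      _ = _ := by field_simp

theorem sharpGNConst_eq {N : ℕ} (hN : 3 ≤ N) : ∀ k ≤ N, sharpGNConst N k =
    (k : ℝ) ^ k / (2 * ((N : ℝ) - 1) / ((N : ℝ) - 2)) ^ (2 * k) *
      ((2 * (N : ℝ) - 2) ^ (2 * N) / (2 * (N : ℝ) - k - 2) ^ (2 * N - k)) *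
      (∏ i ∈ Finset.range k, bracketIntegral ((N : ℝ) - i / 2)) ^ 2
  | 0, _ => by
    have h2 : (3 : ℝ) ≤ N := by exact_mod_cast hN
    have h : (2 * (N : ℝ) - 2) ^ (2 * N) ≠ 0 := (pow_pos (by linarith) _).ne'
    simp [sharpGNConst, h]
  | k + 1, hk => by
    have ih := sharpGNConst_eq hN k (by omega)
    have h1 : (k : ℝ) + 1 ≤ N := by exact_mod_cast hk
    have h2 : (3 : ℝ) ≤ N := by exact_mod_cast hN
    have hr : 0 < 2 * ((N : ℝ) - 1) / ((N : ℝ) - 2) := div_pos (by linarith) (by linarith)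
    have h3 : (2 * (N : ℝ) - k - 2) ^ (2 * N - k) ≠ 0 := (pow_pos (by linarith) _).ne'
    have h4 : (2 * (N : ℝ) - k - 3) ^ (2 * N - k - 1) ≠ 0 := (pow_pos (by linarith) _).ne'
    have hkk : (k : ℝ) ^ k ≠ 0 := by
      rcases Nat.eq_zero_or_pos k with rfl | hk
      · simp
      · positivity
    rw [sharpGNConst, ih, Finset.prod_range_succ, show 2 * N - (k + 1) = 2 * N - k - 1 by omega,
      show (2 * (N : ℝ) - ((k + 1 : ℕ) : ℝ) - 2) = 2 * (N : ℝ) - k - 3 by push_cast; ring,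
      show (2 * (N : ℝ) - k) / 2 = N - k / 2 by ring]
    push_cast
    set r := 2 * ((N : ℝ) - 1) / ((N : ℝ) - 2)
    set A := (2 * (N : ℝ) - k - 2) ^ (2 * N - k)
    set B := (2 * (N : ℝ) - k - 3) ^ (2 * N - k - 1)
    set C := (2 * (N : ℝ) - 2) ^ (2 * N)
    set P := ∏ i ∈ Finset.range k, bracketIntegral ((N : ℝ) - i / 2)
    set S := bracketIntegral ((N : ℝ) - k / 2)
    rw [show 2 * (k + 1) = 2 * k + 2 by ring, pow_add r]
    field_simp

theorem sharpGNConst_self {N : ℕ} (hN : 3 ≤ N) : sharpGNConst N N =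
    ((N : ℝ) * ((N : ℝ) - 2)) ^ N *
      (∏ i ∈ Finset.range N, bracketIntegral ((N : ℝ) - i / 2)) ^ 2 := by
  have h2 : (3 : ℝ) ≤ N := by exact_mod_cast hN
  have h3 : (0 : ℝ) < (N : ℝ) - 2 := by linarith
  have h4 : (0 : ℝ) < (N : ℝ) - 1 := by linarith
  rw [sharpGNConst_eq hN N le_rfl, show 2 * N - N = N by omega,
    show 2 * (N : ℝ) - N - 2 = N - 2 by ring, show 2 * (N : ℝ) - 2 = 2 * (N - 1) by ring]
  congr 1
  rw [div_pow, mul_pow, mul_pow, two_mul N, pow_add ((N : ℝ) - 2)]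
  field_simp

theorem integrable_one_add_sum_sq_rpow_neg {k : ℕ} {γ : ℝ} (hγ : (k : ℝ) / 2 < γ) :
    Integrable fun x : Fin k → ℝ => (1 + ∑ i, x i ^ 2) ^ (-γ) := by
  have h := integrable_rpow_neg_one_add_norm_sq (E := EuclideanSpace ℝ (Fin k)) (μ := volume)
    (r := 2 * γ) (by simp; linarith)
  have h' := (PiLp.volume_preserving_toLp (Fin k)).integrable_comp_of_integrable h
  refine h'.congr (.of_forall fun x => ?_)
  simp only [Function.comp_apply, EuclideanSpace.norm_sq_eq, Real.norm_eq_abs, sq_abs]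
  congr 1
  ring

theorem integral_add_sum_sq_rpow_neg {k : ℕ} {γ c : ℝ} (hc : 0 < c) :
    ∫ x : Fin k → ℝ, (c + ∑ i, x i ^ 2) ^ (-γ) =
      c ^ (-(γ - k / 2)) * ∫ x : Fin k → ℝ, (1 + ∑ i, x i ^ 2) ^ (-γ) := by
  have h := Measure.integral_comp_smul (volume : Measure (Fin k → ℝ))
    (fun x => (c + ∑ i, x i ^ 2) ^ (-γ)) (Real.sqrt c)
  have e : ∀ x : Fin k → ℝ, (c + ∑ i, (Real.sqrt c • x) i ^ 2) ^ (-γ) =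
      c ^ (-γ) * (1 + ∑ i, x i ^ 2) ^ (-γ) := fun x => by
    rw [← Real.mul_rpow hc.le (by positivity)]
    congr 1
    simp only [Pi.smul_apply, smul_eq_mul, mul_pow, Real.sq_sqrt hc.le, ← Finset.mul_sum]
    ring
  simp only [e, integral_const_mul, Module.finrank_pi, Fintype.card_fin, smul_eq_mul] at h
  have hs : |(Real.sqrt c ^ k)⁻¹| = c ^ (-((k : ℝ) / 2)) := by
    rw [abs_of_nonneg (by positivity), Real.rpow_neg hc.le, Real.sqrt_eq_rpow,
      ← Real.rpow_natCast, ← Real.rpow_mul hc.le]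
    congr 2
    ring
  rw [hs] at h
  rw [show -(γ - (k : ℝ) / 2) = -γ + k / 2 by ring, Real.rpow_add hc, mul_right_comm, h,
    Real.rpow_neg hc.le ((k : ℝ) / 2)]
  have : c ^ ((k : ℝ) / 2) ≠ 0 := (Real.rpow_pos_of_pos hc _).ne'
  field_simp

theorem integral_one_add_sum_sq_rpow_neg {γ : ℝ} : ∀ k : ℕ, (k : ℝ) / 2 < γ →
    ∫ x : Fin k → ℝ, (1 + ∑ i, x i ^ 2) ^ (-γ) =
      ∏ i ∈ Finset.range k, bracketIntegral (γ - i / 2)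
  | 0, _ => by
    rw [volume_pi, Measure.pi_of_empty _ default, integral_dirac]
    simp
  | k + 1, hk => by
    push_cast at hk
    rw [integral_fin_cons (integrable_one_add_sum_sq_rpow_neg (by push_cast; linarith)),
      Finset.prod_range_succ, ← integral_one_add_sum_sq_rpow_neg k (by linarith)]
    have e : ∀ (t : ℝ), ∫ y : Fin k → ℝ,
        (1 + ∑ i, (Fin.cons t y : Fin (k + 1) → ℝ) i ^ 2) ^ (-γ) =
        (1 + t ^ 2) ^ (-(γ - k / 2)) * ∫ x : Fin k → ℝ, (1 + ∑ i, x i ^ 2) ^ (-γ) := fun t => by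
      rw [← integral_add_sum_sq_rpow_neg (by positivity)]
      simp [Fin.sum_univ_succ, add_assoc]
    simp only [e, integral_mul_const, bracketIntegral]
    ring

/-- The sharp Sobolev inequality on Euclidean space. -/
theorem sharp_sobolev {d : ℕ} (hd : 3 ≤ d) {f : EuclideanSpace ℝ (Fin d) → ℂ}
    (hf : ContDiff ℝ 1 f) (hfc : HasCompactSupport f) :
    ((d : ℝ) * ((d : ℝ) - 2)) ^ d *
        (∫ x : EuclideanSpace ℝ (Fin d), (1 + ‖x‖ ^ 2) ^ (-(d : ℝ))) ^ 2 *
        (∫ x, ‖f x‖ ^ (2 * (d : ℝ) / ((d : ℝ) - 2))) ^ (d - 2) ≤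
      (∫ x, ∑ i, ‖fderiv ℝ f x (EuclideanSpace.single i 1)‖ ^ 2) ^ d := by
  have htr : ∀ g : EuclideanSpace ℝ (Fin d) → ℝ,
      ∫ x, g x = ∫ x : Fin d → ℝ, g (WithLp.toLp 2 x) := fun g =>
    ((PiLp.volume_preserving_toLp (Fin d)).integral_comp
      (MeasurableEquiv.toLp 2 (Fin d → ℝ)).measurableEmbedding g).symm
  have key := sharp_gagliardo_nirenberg hd d 0 rfl (fun x => f (WithLp.toLp 2 x))
    (hf.comp (EuclideanSpace.equiv (Fin d) ℝ).symm.contDiff)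
    (hfc.comp_homeomorph (EuclideanSpace.equiv (Fin d) ℝ).symm.toHomeomorph)
  have hfd : ∀ (x : Fin d → ℝ) (i : Fin d),
      fderiv ℝ (fun x => f (WithLp.toLp 2 x)) x (Pi.single i 1) =
        fderiv ℝ f (WithLp.toLp 2 x) (EuclideanSpace.single i 1) := fun x i => by
    have := ((hf.differentiable one_ne_zero (WithLp.toLp 2 x)).hasFDerivAt).comp x
      ((EuclideanSpace.equiv (Fin d) ℝ).symm.hasFDerivAt (x := x))
    rw [show fderiv ℝ (fun x => f (WithLp.toLp 2 x)) x = _ from this.fderiv]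
    rfl
  rw [htr, htr, htr]
  simp only [hfd, add_zero, mul_zero, pow_zero, mul_one, sharpGNConst_self hd] at key
  rw [← integral_one_add_sum_sq_rpow_neg d (by
    have : (3 : ℝ) ≤ d := by exact_mod_cast hd
    linarith)] at key
  simpa only [EuclideanSpace.norm_sq_eq, Real.norm_eq_abs, sq_abs] using key

theorem hasFDerivAt_norm_rpow_of_ne {F : Type*} [NormedAddCommGroup F] [InnerProductSpace ℝ F]
    {x : F} (hx : x ≠ 0) (e : ℝ) :
    HasFDerivAt (fun x : F => ‖x‖ ^ e) ((e * ‖x‖ ^ (e - 2)) • innerSL ℝ x) x := by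
  have hx0 : 0 < ‖x‖ := norm_pos_iff.2 hx
  have h := (hasStrictFDerivAt_norm_sq x).hasFDerivAt.rpow_const (p := e / 2) (Or.inl (by positivity))
  have hpow : ∀ (y : F) (q : ℝ), (‖y‖ ^ 2) ^ q = ‖y‖ ^ (2 * q) := fun y q => by
    rw [← Real.rpow_natCast, ← Real.rpow_mul (norm_nonneg y)]
    norm_num
  simp only [hpow] at h
  rw [show 2 * (e / 2) = e by ring, show 2 * (e / 2 - 1) = e - 2 by ring] at h
  refine h.congr_fderiv ?_
  ext v
  simp
  ring

/-- The squared Hilbert-Schmidt norm of a linear map, computed in the standard basis. -/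
noncomputable def gradSq {d : ℕ} (L : EuclideanSpace ℝ (Fin d) →L[ℝ] ℂ) : ℝ :=
  ∑ i, ‖L (EuclideanSpace.single i 1)‖ ^ 2

theorem gradSq_nonneg {d : ℕ} (L : EuclideanSpace ℝ (Fin d) →L[ℝ] ℂ) : 0 ≤ gradSq L :=
  Finset.sum_nonneg fun _ _ => by positivity

theorem gradSq_smul {d : ℕ} (c : ℝ) (L : EuclideanSpace ℝ (Fin d) →L[ℝ] ℂ) :
    gradSq (c • L) = c ^ 2 * gradSq L := by
  simp [gradSq, mul_pow, Finset.mul_sum]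

theorem continuous_gradSq {d : ℕ} :
    Continuous (gradSq : (EuclideanSpace ℝ (Fin d) →L[ℝ] ℂ) → ℝ) :=
  continuous_finsetSum _ fun i _ =>
    ((ContinuousLinearMap.apply ℝ ℂ (EuclideanSpace.single i (1 : ℝ))).continuous.norm).pow 2

theorem apply_eq_sum_smul_single {d : ℕ} {V : Type*} [NormedAddCommGroup V] [NormedSpace ℝ V]
    (L : EuclideanSpace ℝ (Fin d) →L[ℝ] V) (x : EuclideanSpace ℝ (Fin d)) :
    L x = ∑ i, x i • L (EuclideanSpace.single i 1) := by
  have h : x = ∑ i, x i • EuclideanSpace.single i (1 : ℝ) := by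
    have := (EuclideanSpace.basisFun (Fin d) ℝ).sum_repr x
    simpa using this.symm
  conv_lhs => rw [h]
  simp

theorem gradSq_add_smulRight {d : ℕ} (L : EuclideanSpace ℝ (Fin d) →L[ℝ] ℂ)
    (x : EuclideanSpace ℝ (Fin d)) (z : ℂ) :
    gradSq (L + (innerSL ℝ x).smulRight z) =
      gradSq L + 2 * inner ℝ (L x) z + ‖x‖ ^ 2 * ‖z‖ ^ 2 := by
  have h : ∀ i : Fin d, ‖(L + (innerSL ℝ x).smulRight z) (EuclideanSpace.single i 1)‖ ^ 2 =
      ‖L (EuclideanSpace.single i 1)‖ ^ 2 +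
        2 * inner ℝ (x i • L (EuclideanSpace.single i 1)) z + x i ^ 2 * ‖z‖ ^ 2 := fun i => by
    have e : (L + (innerSL ℝ x).smulRight z) (EuclideanSpace.single i 1) =
        L (EuclideanSpace.single i 1) + x i • z := by
      simp [EuclideanSpace.inner_single_right]
    rw [e, norm_add_sq_real, norm_smul, inner_smul_left, inner_smul_right, mul_pow,
      Real.norm_eq_abs, sq_abs]
    simp
  rw [gradSq, Finset.sum_congr rfl fun i _ => h i, Finset.sum_add_distrib, Finset.sum_add_distrib,
    ← Finset.mul_sum, ← sum_inner, ← apply_eq_sum_smul_single, ← Finset.sum_mul,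
    EuclideanSpace.norm_sq_eq]
  simp [gradSq]

theorem norm_apply_sq_le_gradSq {d : ℕ} (L : EuclideanSpace ℝ (Fin d) →L[ℝ] ℂ)
    (x : EuclideanSpace ℝ (Fin d)) : ‖L x‖ ^ 2 ≤ ‖x‖ ^ 2 * gradSq L := by
  rcases eq_or_ne x 0 with rfl | hx
  · simp
  have hx0 : 0 < ‖x‖ := norm_pos_iff.2 hx
  have h := gradSq_nonneg (L + (innerSL ℝ x).smulRight (-(‖x‖ ^ 2)⁻¹ • L x))
  rw [gradSq_add_smulRight, inner_smul_right, real_inner_self_eq_norm_sq, norm_smul, mul_pow,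
    norm_neg, Real.norm_eq_abs, sq_abs] at h
  have e : gradSq L + 2 * (-(‖x‖ ^ 2)⁻¹ * ‖L x‖ ^ 2) + ‖x‖ ^ 2 * ((‖x‖ ^ 2)⁻¹ ^ 2 * ‖L x‖ ^ 2) =
      gradSq L - ‖L x‖ ^ 2 / ‖x‖ ^ 2 := by
    field_simp
    ring
  rw [e, sub_nonneg, div_le_iff₀ (by positivity)] at h
  linarith

theorem contDiff_of_ne_zero {E V : Type*} [NormedAddCommGroup E] [NormedSpace ℝ E]
    [NormedAddCommGroup V] [NormedSpace ℝ V] {g : E → V}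
    (hg : ∀ x ≠ 0, ContDiffAt ℝ 1 g x) (h0 : (0 : E) ∉ tsupport g) : ContDiff ℝ 1 g := by
  rw [contDiff_iff_contDiffAt]
  intro x
  rcases eq_or_ne x 0 with rfl | hx
  · exact contDiffAt_const.congr_of_eventuallyEq (notMem_tsupport_iff_eventuallyEq.1 h0)
  · exact hg x hx

theorem contDiffAt_norm_rpow_of_ne {F : Type*} [NormedAddCommGroup F] [InnerProductSpace ℝ F]
    {x : F} (hx : x ≠ 0) (e : ℝ) : ContDiffAt ℝ 1 (fun x : F => ‖x‖ ^ e) x :=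
  (contDiffAt_norm ℝ hx).rpow_const_of_ne (norm_ne_zero_iff.2 hx)

theorem continuousOn_norm_rpow_compl_zero {F : Type*} [NormedAddCommGroup F] (e : ℝ) :
    ContinuousOn (fun x : F => ‖x‖ ^ e) {0}ᶜ := fun _ hx =>
  (continuousAt_id.norm.rpow_const (Or.inl (norm_ne_zero_iff.2 hx))).continuousWithinAt

theorem integrable_of_continuousOn_compl_zero {E : Type*} [NormedAddCommGroup E]
    [MeasurableSpace E] [BorelSpace E] {ν : Measure E} [IsFiniteMeasureOnCompacts ν]
    {u : E → ℝ} {k : Set E} (hk : IsCompact k) (hk0 : (0 : E) ∉ k) (hu : ContinuousOn u {0}ᶜ)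
    (hsupp : ∀ x ∉ k, u x = 0) : Integrable u ν := by
  rw [← integrableOn_iff_integrable_of_support_subset (s := k)]
  · exact (hu.mono fun x hx h => hk0 (h ▸ hx)).integrableOn_compact hk
  · intro x hx
    by_contra h
    exact hx (hsupp x h)

/-- Euler's identity: the divergence of `x ↦ G x • x` integrates to zero. -/
theorem integral_fderiv_apply_self {d : ℕ} {G : EuclideanSpace ℝ (Fin d) → ℝ}
    (hG : ContDiff ℝ 1 G) (hGc : HasCompactSupport G) :
    Integrable (fun x => fderiv ℝ G x x) ∧ ∫ x, fderiv ℝ G x x = -d * ∫ x, G x := by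
  have hcont : ∀ v, Continuous fun x => fderiv ℝ G x v := fun v =>
    (hG.continuous_fderiv one_ne_zero).clm_apply continuous_const
  have hzero : ∀ x ∉ tsupport G, fderiv ℝ G x = 0 := fun x hx => by
    by_contra h
    exact hx (support_fderiv_subset ℝ h)
  have hi1 : ∀ i : Fin d, Integrable fun x : EuclideanSpace ℝ (Fin d) =>
      x i * fderiv ℝ G x (EuclideanSpace.single i 1) := fun i => by
    refine Continuous.integrable_of_hasCompactSupport ((by fun_prop : Continuous fun x :
      EuclideanSpace ℝ (Fin d) => x i).mul (hcont _)) ?_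
    exact HasCompactSupport.intro' hGc (isClosed_tsupport G) fun x hx => by simp [hzero x hx]
  have hi2 : Integrable G := hG.continuous.integrable_of_hasCompactSupport hGc
  have hfd : ∀ (i : Fin d) (x : EuclideanSpace ℝ (Fin d)),
      fderiv ℝ (fun x : EuclideanSpace ℝ (Fin d) => x i) x (EuclideanSpace.single i 1) = 1 :=
    fun i x => by
      have := (EuclideanSpace.proj i : EuclideanSpace ℝ (Fin d) →L[ℝ] ℝ).hasFDerivAt (x := x)
      rw [show fderiv ℝ (fun x : EuclideanSpace ℝ (Fin d) => x i) x = _ from this.fderiv]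
      simp
  have hibp : ∀ i : Fin d, ∫ x : EuclideanSpace ℝ (Fin d),
      x i * fderiv ℝ G x (EuclideanSpace.single i 1) = -∫ x, G x := fun i => by
    have := integral_mul_fderiv_eq_neg_fderiv_mul_of_integrable (μ := volume)
      (f := fun x : EuclideanSpace ℝ (Fin d) => x i) (g := G) (v := EuclideanSpace.single i 1)
      (by simpa only [hfd, one_mul] using hi2) (hi1 i)
      (((by fun_prop : Continuous fun x : EuclideanSpace ℝ (Fin d) => x i).mul
        hG.continuous).integrable_of_hasCompactSupport hGc.mul_left)
      (fun x _ => by fun_prop) (fun x _ => hG.differentiable one_ne_zero x)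
    simpa only [hfd, one_mul] using this
  have hsum : ∀ x, fderiv ℝ G x x =
      ∑ i, x i * fderiv ℝ G x (EuclideanSpace.single i 1) := fun x => by
    simpa only [smul_eq_mul] using apply_eq_sum_smul_single (fderiv ℝ G x) x
  simp only [hsum]
  refine ⟨integrable_finsetSum _ fun i _ => hi1 i, ?_⟩
  rw [integral_finsetSum _ fun i _ => hi1 i, Finset.sum_congr rfl fun i _ => hibp i]
  simp

theorem norm_rpow_smul_mem_test {E : Type*} [NormedAddCommGroup E] [InnerProductSpace ℝ E]
    {φ : E → ℂ} (hφ : ContDiff ℝ 1 φ) (hφc : HasCompactSupport φ) (hφ0 : (0 : E) ∉ tsupport φ)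
    (e : ℝ) :
    ContDiff ℝ 1 (fun x => ‖x‖ ^ e • φ x) ∧ HasCompactSupport (fun x => ‖x‖ ^ e • φ x) ∧
      (0 : E) ∉ tsupport (fun x => ‖x‖ ^ e • φ x) := by
  have hsub : tsupport (fun x => ‖x‖ ^ e • φ x) ⊆ tsupport φ :=
    closure_mono fun x hx h => hx (by simp [h])
  have h0 := fun h => hφ0 (hsub h)
  exact ⟨contDiff_of_ne_zero
    (fun x hx => (contDiffAt_norm_rpow_of_ne hx e).smul hφ.contDiffAt) h0,
    hφc.mono' ((subset_tsupport _).trans hsub), h0⟩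

/-- The ground state substitution for the Hardy inequality. -/
theorem integral_gradSq_norm_rpow_smul {d : ℕ} (hd : 3 ≤ d) {φ : EuclideanSpace ℝ (Fin d) → ℂ}
    (hφ : ContDiff ℝ 1 φ) (hφc : HasCompactSupport φ)
    (hφ0 : (0 : EuclideanSpace ℝ (Fin d)) ∉ tsupport φ) :
    ∫ x, gradSq (fderiv ℝ (fun x => ‖x‖ ^ (-(((d : ℝ) - 2) / 2)) • φ x) x) =
      (∫ x, ‖x‖ ^ (-(d : ℝ)) * (‖x‖ ^ 2 * gradSq (fderiv ℝ φ x))) +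
        (((d : ℝ) - 2) / 2) ^ 2 * ∫ x, ‖x‖ ^ (-(d : ℝ)) * ‖φ x‖ ^ 2 := by
  set s : ℝ := ((d : ℝ) - 2) / 2 with hs
  have hne : ∀ᵐ x : EuclideanSpace ℝ (Fin d), x ≠ 0 := by
    have : Nontrivial (Fin d) := Fin.nontrivial_iff_two_le.2 (by omega)
    exact Measure.ae_ne volume 0
  set G : EuclideanSpace ℝ (Fin d) → ℝ := fun x => ‖x‖ ^ (-(d : ℝ)) * ‖φ x‖ ^ 2 with hG
  have hsub : tsupport G ⊆ tsupport φ := closure_mono fun x hx h => hx (by simp [hG, h])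
  have hGd : ContDiff ℝ 1 G := contDiff_of_ne_zero
    (fun x hx => (contDiffAt_norm_rpow_of_ne hx _).mul (hφ.contDiffAt.norm_sq ℝ)) fun h => hφ0 (hsub h)
  have hGc : HasCompactSupport G := hφc.mono' ((subset_tsupport _).trans hsub)
  obtain ⟨hi1, hE⟩ := integral_fderiv_apply_self hGd hGc
  have hi2 : Integrable G := hGd.continuous.integrable_of_hasCompactSupport hGc
  have hi3 : Integrable fun x => ‖x‖ ^ (-(d : ℝ)) * (‖x‖ ^ 2 * gradSq (fderiv ℝ φ x)) := by
    refine integrable_of_continuousOn_compl_zero hφc hφ0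
      ((continuousOn_norm_rpow_compl_zero _).mul (Continuous.continuousOn ?_)) fun x hx => ?_
    · exact (continuous_norm.pow 2).mul (continuous_gradSq.comp (hφ.continuous_fderiv one_ne_zero))
    · have h2 : fderiv ℝ φ x = 0 := by
        by_contra h
        exact hx (support_fderiv_subset ℝ h)
      simp [h2, gradSq]
  have hpt : ∀ x : EuclideanSpace ℝ (Fin d), x ≠ 0 →
      gradSq (fderiv ℝ (fun x => ‖x‖ ^ (-s) • φ x) x) =
        (‖x‖ ^ (-(d : ℝ)) * (‖x‖ ^ 2 * gradSq (fderiv ℝ φ x)) + s ^ 2 * G x) -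
          (s * fderiv ℝ G x x + s * (d * G x)) := by
    intro x hx
    have hx0 : 0 < ‖x‖ := norm_pos_iff.2 hx
    have hdφ := (hφ.differentiable one_ne_zero x).hasFDerivAt
    have h1 := (hasFDerivAt_norm_rpow_of_ne hx (-s)).fun_smul hdφ
    have h2 := (hasFDerivAt_norm_rpow_of_ne hx (-(d : ℝ))).mul hdφ.norm_sq
    rw [h1.fderiv, show fderiv ℝ G x = _ from h2.fderiv]
    have e1 : ‖x‖ ^ (-s) • fderiv ℝ φ x +
        ((-s * ‖x‖ ^ (-s - 2)) • innerSL ℝ x).smulRight (φ x) =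
        ‖x‖ ^ (-s) • (fderiv ℝ φ x + (innerSL ℝ x).smulRight ((-s * ‖x‖ ^ (-2 : ℝ)) • φ x)) := by
      ext v
      rw [sub_eq_add_neg, Real.rpow_add hx0]
      simp
      ring
    have e2 : (‖x‖ ^ (-s)) ^ 2 = ‖x‖ ^ (-(d : ℝ)) * ‖x‖ ^ 2 := by
      rw [← Real.rpow_natCast, ← Real.rpow_natCast, ← Real.rpow_mul hx0.le, ← Real.rpow_add hx0,
        hs]
      congr 1
      push_cast
      ring
    have e3 : ‖x‖ ^ (-2 : ℝ) = (‖x‖ ^ 2)⁻¹ := by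
      rw [Real.rpow_neg hx0.le]
      norm_num
    have e4 : ‖x‖ ^ (-(d : ℝ) - 2) = ‖x‖ ^ (-(d : ℝ)) * (‖x‖ ^ 2)⁻¹ := by
      rw [sub_eq_add_neg, Real.rpow_add hx0, e3]
    rw [e1, gradSq_smul, gradSq_add_smulRight, e2, e3, inner_smul_right, norm_smul, mul_pow,
      Real.norm_eq_abs, sq_abs]
    simp only [add_apply, smul_apply, smul_eq_mul, innerSL_apply_apply,
      ContinuousLinearMap.comp_apply, real_inner_self_eq_norm_sq, e4, hG]
    rw [real_inner_comm]
    field_simp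
    ring
  rw [integral_congr_ae (hne.mono hpt), integral_sub (hi3.fun_add (hi2.const_mul _))
    ((hi1.const_mul _).fun_add ((hi2.const_mul _).const_mul _)), integral_add hi3 (hi2.const_mul _),
    integral_add (hi1.const_mul _) ((hi2.const_mul _).const_mul _), integral_const_mul,
    integral_const_mul, integral_const_mul, integral_const_mul, hE]
  ring

/-- The radial map raising the norm to the power `κ`. -/
noncomputable def radialPow {E : Type*} [NormedAddCommGroup E] [InnerProductSpace ℝ E] (κ : ℝ)
    (y : E) : E := ‖y‖ ^ (κ - 1) • y

section radialPow

variable {E : Type*} [NormedAddCommGroup E] [InnerProductSpace ℝ E] {κ : ℝ} {y : E}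

theorem radialPow_zero : radialPow κ (0 : E) = 0 := by simp [radialPow]

theorem norm_radialPow (hy : y ≠ 0) : ‖radialPow κ y‖ = ‖y‖ ^ κ := by
  have hy0 : 0 < ‖y‖ := norm_pos_iff.2 hy
  rw [radialPow, norm_smul, Real.norm_of_nonneg (by positivity), Real.rpow_sub_one hy0.ne']
  field_simp

theorem radialPow_ne_zero (hy : y ≠ 0) : radialPow κ y ≠ 0 :=
  smul_ne_zero (Real.rpow_pos_of_pos (norm_pos_iff.2 hy) _).ne' hy

theorem radialPow_inv_radialPow (hκ : κ ≠ 0) (y : E) : radialPow κ⁻¹ (radialPow κ y) = y := by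
  rcases eq_or_ne y 0 with rfl | hy
  · simp [radialPow_zero]
  have hy0 : 0 < ‖y‖ := norm_pos_iff.2 hy
  rw [radialPow, norm_radialPow hy, radialPow, smul_smul, ← Real.rpow_mul hy0.le,
    ← Real.rpow_add hy0, mul_sub, mul_inv_cancel₀ hκ]
  simp

theorem hasFDerivAt_radialPow (hy : y ≠ 0) (κ : ℝ) : HasFDerivAt (radialPow κ : E → E)
    (‖y‖ ^ (κ - 1) • (ContinuousLinearMap.id ℝ E +
      (innerSL ℝ y).smulRight (((κ - 1) * (‖y‖ ^ 2)⁻¹) • y))) y := by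
  have hy0 : 0 < ‖y‖ := norm_pos_iff.2 hy
  have h := (hasFDerivAt_norm_rpow_of_ne hy (κ - 1)).fun_smul (hasFDerivAt_id y)
  refine h.congr_fderiv ?_
  ext v
  rw [sub_eq_add_neg (κ - 1) 2, Real.rpow_add hy0, Real.rpow_neg hy0.le, Real.rpow_two]
  simp only [id, add_apply, smul_apply, ContinuousLinearMap.smulRight_apply,
    ContinuousLinearMap.id_apply, smul_add, smul_smul, smul_eq_mul]
  congr 2
  ring

theorem contDiffAt_radialPow (hy : y ≠ 0) (κ : ℝ) : ContDiffAt ℝ 1 (radialPow κ : E → E) y :=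
  (contDiffAt_norm_rpow_of_ne hy _).smul contDiffAt_id

theorem det_fderiv_radialPow [FiniteDimensional ℝ E] (hy : y ≠ 0) :
    (‖y‖ ^ (κ - 1) • (ContinuousLinearMap.id ℝ E +
      (innerSL ℝ y).smulRight (((κ - 1) * (‖y‖ ^ 2)⁻¹) • y))).det =
      κ * (‖y‖ ^ (κ - 1)) ^ Module.finrank ℝ E := by
  have hy0 : 0 < ‖y‖ := norm_pos_iff.2 hy
  have h : ((‖y‖ ^ (κ - 1) • (ContinuousLinearMap.id ℝ E +
      (innerSL ℝ y).smulRight (((κ - 1) * (‖y‖ ^ 2)⁻¹) • y)) : E →L[ℝ] E) : E →ₗ[ℝ] E) =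
      ‖y‖ ^ (κ - 1) • LinearMap.transvection (innerSL ℝ y : E →ₗ[ℝ] ℝ)
        (((κ - 1) * (‖y‖ ^ 2)⁻¹) • y) := by
    ext v
    simp [LinearMap.transvection]
  rw [ContinuousLinearMap.det, h, LinearMap.det_smul, LinearMap.transvection.det]
  simp only [ContinuousLinearMap.coe_coe, innerSL_apply_apply, inner_smul_right,
    real_inner_self_eq_norm_sq]
  field_simp
  ring

theorem integral_norm_rpow_neg_finrank_mul [FiniteDimensional ℝ E] [Nontrivial E]
    [MeasurableSpace E] [BorelSpace E]
    {ν : Measure E} [ν.IsAddHaarMeasure] (hκ : 0 < κ) (g : E → ℝ) :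
    ∫ x, ‖x‖ ^ (-(Module.finrank ℝ E : ℝ)) * g x ∂ν =
      κ * ∫ y, ‖y‖ ^ (-(Module.finrank ℝ E : ℝ)) * g (radialPow κ y) ∂ν := by
  have hinj : Set.InjOn (radialPow κ) ({0}ᶜ : Set E) := fun x _ y _ h => by
    rw [← radialPow_inv_radialPow hκ.ne' x, h, radialPow_inv_radialPow hκ.ne' y]
  have himg : radialPow κ '' ({0}ᶜ : Set E) = {0}ᶜ := by
    ext x
    refine ⟨?_, fun hx => ⟨radialPow κ⁻¹ x, radialPow_ne_zero hx, ?_⟩⟩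
    · rintro ⟨y, hy, rfl⟩
      exact radialPow_ne_zero hy
    · simpa using radialPow_inv_radialPow (inv_ne_zero hκ.ne') x
  have h := integral_image_eq_integral_abs_det_fderiv_smul ν (measurableSet_singleton 0).compl
    (fun y hy => (hasFDerivAt_radialPow hy κ).hasFDerivWithinAt) hinj
    (fun x => ‖x‖ ^ (-(Module.finrank ℝ E : ℝ)) * g x)
  rw [himg, restrict_compl_singleton] at h
  rw [h, ← integral_const_mul]
  refine integral_congr_ae ?_
  filter_upwards [Measure.ae_ne ν 0] with y hy
  have hy0 : 0 < ‖y‖ := norm_pos_iff.2 hy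
  rw [det_fderiv_radialPow hy, abs_of_nonneg (by positivity), norm_radialPow hy, smul_eq_mul,
    ← mul_assoc, ← mul_assoc]
  congr 1
  rw [mul_assoc, ← Real.rpow_natCast, ← Real.rpow_mul hy0.le, ← Real.rpow_mul hy0.le,
    ← Real.rpow_add hy0]
  congr 2
  ring

theorem isCompact_image_radialPow {k : Set E} (hk : IsCompact k) (hk0 : (0 : E) ∉ k) :
    IsCompact (radialPow κ '' k) :=
  hk.image_of_continuousOn fun _ hx =>
    (contDiffAt_radialPow (fun h => hk0 (h ▸ hx)) _).continuousAt.continuousWithinAt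

theorem zero_notMem_image_radialPow {k : Set E} (hk0 : (0 : E) ∉ k) :
    (0 : E) ∉ radialPow κ '' k := by
  rintro ⟨x, hx, hx0⟩
  exact radialPow_ne_zero (fun h => hk0 (h ▸ hx)) hx0

theorem comp_radialPow_mem_test (hκ : κ ≠ 0) {φ : E → ℂ} (hφ : ContDiff ℝ 1 φ)
    (hφc : HasCompactSupport φ) (hφ0 : (0 : E) ∉ tsupport φ) :
    ContDiff ℝ 1 (fun y => φ (radialPow κ y)) ∧ HasCompactSupport (fun y => φ (radialPow κ y)) ∧
      (0 : E) ∉ tsupport (fun y => φ (radialPow κ y)) := by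
  have hK : IsCompact (radialPow κ⁻¹ '' tsupport φ) := isCompact_image_radialPow hφc hφ0
  have hsub : tsupport (fun y => φ (radialPow κ y)) ⊆ radialPow κ⁻¹ '' tsupport φ :=
    closure_minimal (fun y hy => ⟨radialPow κ y, subset_tsupport _ hy,
      radialPow_inv_radialPow hκ y⟩) hK.isClosed
  have h0 := fun h => zero_notMem_image_radialPow hφ0 (hsub h)
  exact ⟨contDiff_of_ne_zero (fun x hx => hφ.contDiffAt.comp x (contDiffAt_radialPow hx κ)) h0,
    hK.of_isClosed_subset (isClosed_tsupport _) hsub, h0⟩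

end radialPow

theorem gradSq_fderiv_comp_radialPow_le {d : ℕ} {φ : EuclideanSpace ℝ (Fin d) → ℂ}
    (hφ : ContDiff ℝ 1 φ) {κ : ℝ} (hκ : 1 ≤ κ) {y : EuclideanSpace ℝ (Fin d)} (hy : y ≠ 0) :
    ‖y‖ ^ 2 * gradSq (fderiv ℝ (fun y => φ (radialPow κ y)) y) ≤
      κ ^ 2 * (‖radialPow κ y‖ ^ 2 * gradSq (fderiv ℝ φ (radialPow κ y))) := by
  have hy0 : 0 < ‖y‖ := norm_pos_iff.2 hy
  have h := ((hφ.differentiable one_ne_zero (radialPow κ y)).hasFDerivAt).comp y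
    (hasFDerivAt_radialPow hy κ)
  rw [show fderiv ℝ (fun y => φ (radialPow κ y)) y = _ from h.fderiv]
  set L := fderiv ℝ φ (radialPow κ y)
  have e : L.comp (‖y‖ ^ (κ - 1) • (ContinuousLinearMap.id ℝ (EuclideanSpace ℝ (Fin d)) +
      (innerSL ℝ y).smulRight (((κ - 1) * (‖y‖ ^ 2)⁻¹) • y))) =
      ‖y‖ ^ (κ - 1) • (L + (innerSL ℝ y).smulRight (((κ - 1) * (‖y‖ ^ 2)⁻¹) • L y)) := by
    ext v
    simp
  have hL := norm_apply_sq_le_gradSq L y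
  rw [e, gradSq_smul, gradSq_add_smulRight, inner_smul_right, real_inner_self_eq_norm_sq,
    norm_smul, norm_radialPow hy, Real.rpow_sub_one hy0.ne', mul_pow, Real.norm_eq_abs, sq_abs]
  have e2 : ‖y‖ ^ 2 * ((‖y‖ ^ κ / ‖y‖) ^ 2 * (gradSq L + 2 * ((κ - 1) * (‖y‖ ^ 2)⁻¹ * ‖L y‖ ^ 2) +
      ‖y‖ ^ 2 * (((κ - 1) * (‖y‖ ^ 2)⁻¹) ^ 2 * ‖L y‖ ^ 2))) =
      (‖y‖ ^ κ) ^ 2 * (gradSq L + (κ ^ 2 - 1) * (‖L y‖ ^ 2 / ‖y‖ ^ 2)) := by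
    field_simp
    ring
  have h1 : ‖L y‖ ^ 2 / ‖y‖ ^ 2 ≤ gradSq L := by
    rw [div_le_iff₀ (by positivity)]
    linarith
  rw [e2]
  calc _ ≤ (‖y‖ ^ κ) ^ 2 * (gradSq L + (κ ^ 2 - 1) * gradSq L) := by
        have : 0 ≤ κ ^ 2 - 1 := by nlinarith
        gcongr
    _ = _ := by ring

theorem integral_norm_rpow_neg_mul {d : ℕ} (hd : 3 ≤ d) {κ : ℝ} (hκ : 0 < κ)
    (g : EuclideanSpace ℝ (Fin d) → ℝ) :
    ∫ x, ‖x‖ ^ (-(d : ℝ)) * g x = κ * ∫ y, ‖y‖ ^ (-(d : ℝ)) * g (radialPow κ y) := by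
  have : NeZero d := ⟨by omega⟩
  have h := integral_norm_rpow_neg_finrank_mul (ν := volume) hκ g
  rwa [finrank_euclideanSpace_fin] at h

/-- The sharp Sobolev inequality for the Schrödinger operator with an attractive inverse square
potential. -/
theorem sharp_hardy_sobolev {d : ℕ} (hd : 3 ≤ d) {β b : ℝ} (hβ : 0 < β) (hβ1 : β ≤ 1)
    (hb : b = (((d : ℝ) - 2) / 2) ^ 2 * (β ^ 2 - 1)) {f : EuclideanSpace ℝ (Fin d) → ℂ}
    (hf : ContDiff ℝ 1 f) (hfc : HasCompactSupport f)
    (hf0 : (0 : EuclideanSpace ℝ (Fin d)) ∉ tsupport f) :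
    0 ≤ (∫ x, gradSq (fderiv ℝ f x)) + b * ∫ x, (‖x‖ ^ 2)⁻¹ * ‖f x‖ ^ 2 ∧
    (β ^ (d - 1) * (((d : ℝ) * ((d : ℝ) - 2)) ^ ((d : ℝ) / 2) *
        ∫ x : EuclideanSpace ℝ (Fin d), (1 + ‖x‖ ^ 2) ^ (-(d : ℝ)))) ^ 2 *
        (∫ x, ‖f x‖ ^ (2 * (d : ℝ) / ((d : ℝ) - 2))) ^ (d - 2) ≤
      ((∫ x, gradSq (fderiv ℝ f x)) + b * ∫ x, (‖x‖ ^ 2)⁻¹ * ‖f x‖ ^ 2) ^ d := by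
  have hd' : (3 : ℝ) ≤ d := by exact_mod_cast hd
  have hd2 : (0 : ℝ) < (d : ℝ) - 2 := by linarith
  set s : ℝ := ((d : ℝ) - 2) / 2 with hs
  set p : ℝ := 2 * (d : ℝ) / ((d : ℝ) - 2) with hp
  have hp0 : 0 < p := by positivity
  have hsp : s * p = d := by
    rw [hs, hp]
    field_simp
  have hκ : 0 < β⁻¹ := by positivity
  have hκ1 : 1 ≤ β⁻¹ := (one_le_inv₀ hβ).2 hβ1
  set φ : EuclideanSpace ℝ (Fin d) → ℂ := fun x => ‖x‖ ^ s • f x with hφdef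
  obtain ⟨hφ, hφc, hφ0⟩ := norm_rpow_smul_mem_test hf hfc hf0 s
  have hf0' : f 0 = 0 := image_eq_zero_of_notMem_tsupport hf0
  have hfφ : (fun x => ‖x‖ ^ (-s) • φ x) = f := by
    ext1 x
    rcases eq_or_ne x 0 with rfl | hx
    · simp [hφdef, hf0']
    have hx0 : 0 < ‖x‖ := norm_pos_iff.2 hx
    rw [hφdef]
    simp only [smul_smul]
    rw [← Real.rpow_add hx0]
    simp
  set P := ∫ x, ‖x‖ ^ (-(d : ℝ)) * (‖x‖ ^ 2 * gradSq (fderiv ℝ φ x)) with hP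
  set R := ∫ x, ‖x‖ ^ (-(d : ℝ)) * ‖φ x‖ ^ 2 with hR
  have hP0 : 0 ≤ P := integral_nonneg fun x => by
    have := gradSq_nonneg (fderiv ℝ φ x)
    positivity
  have hR0 : 0 ≤ R := integral_nonneg fun x => by positivity
  have hQ := integral_gradSq_norm_rpow_smul hd hφ hφc hφ0
  rw [← hs, hfφ, ← hP, ← hR] at hQ
  have hpow : ∀ ψ : EuclideanSpace ℝ (Fin d) → ℂ, ψ 0 = 0 →
      ∫ x, ‖‖x‖ ^ (-s) • ψ x‖ ^ p = ∫ x, ‖x‖ ^ (-(d : ℝ)) * ‖ψ x‖ ^ p := fun ψ hψ => by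
    congr 1
    ext x
    rcases eq_or_ne x 0 with rfl | hx
    · simp [hψ, hp0.ne']
    rw [norm_smul, Real.mul_rpow (by positivity) (by positivity),
      Real.norm_of_nonneg (by positivity), ← Real.rpow_mul (norm_nonneg _)]
    congr 2
    linarith
  have hsq : ∫ x, (‖x‖ ^ 2)⁻¹ * ‖f x‖ ^ 2 = R := by
    rw [hR]
    congr 1
    ext x
    rcases eq_or_ne x 0 with rfl | hx
    · simp [hφdef, hf0']
    have hx0 : 0 < ‖x‖ := norm_pos_iff.2 hx
    rw [hφdef]
    simp only [norm_smul, mul_pow]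
    rw [Real.norm_of_nonneg (by positivity), ← mul_assoc, ← Real.rpow_natCast (‖x‖ ^ s),
      ← Real.rpow_mul hx0.le, ← Real.rpow_add hx0]
    congr 1
    rw [← Real.rpow_natCast ‖x‖, ← Real.rpow_neg hx0.le, hs]
    congr 1
    push_cast
    ring
  have hQ' : (∫ x, gradSq (fderiv ℝ f x)) + b * ∫ x, (‖x‖ ^ 2)⁻¹ * ‖f x‖ ^ 2 =
      P + s ^ 2 * β ^ 2 * R := by
    rw [hQ, hsq, hb]
    ring
  rw [hQ']
  refine ⟨by positivity, ?_⟩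
  obtain ⟨hψ, hψc, hψ0⟩ := comp_radialPow_mem_test (κ := β⁻¹) hκ.ne' hφ hφc hφ0
  set ψ : EuclideanSpace ℝ (Fin d) → ℂ := fun y => φ (radialPow β⁻¹ y) with hψdef
  obtain ⟨hg, hgc, -⟩ := norm_rpow_smul_mem_test hψ hψc hψ0 (-s)
  have hsob := sharp_sobolev hd hg hgc
  have hDg := integral_gradSq_norm_rpow_smul hd hψ hψc hψ0
  rw [hpow ψ (image_eq_zero_of_notMem_tsupport hψ0)] at hsob
  have hR' : ∫ x, ‖x‖ ^ (-(d : ℝ)) * ‖ψ x‖ ^ 2 = β * R := by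
    rw [hR, integral_norm_rpow_neg_mul hd hκ (fun x => ‖φ x‖ ^ 2), mul_inv_cancel_left₀ hβ.ne']
  have hM' : ∫ x, ‖x‖ ^ (-(d : ℝ)) * ‖ψ x‖ ^ p = β * ∫ x, ‖f x‖ ^ p := by
    conv_rhs => rw [← hfφ]
    rw [hpow φ (image_eq_zero_of_notMem_tsupport hφ0),
      integral_norm_rpow_neg_mul hd hκ (fun x => ‖φ x‖ ^ p), mul_inv_cancel_left₀ hβ.ne']
  have hInt : Integrable fun y => ‖y‖ ^ (-(d : ℝ)) *
      ((β⁻¹) ^ 2 * (‖radialPow β⁻¹ y‖ ^ 2 * gradSq (fderiv ℝ φ (radialPow β⁻¹ y)))) := by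
    refine integrable_of_continuousOn_compl_zero
      (isCompact_image_radialPow (κ := β) hφc hφ0) (zero_notMem_image_radialPow hφ0)
      ((continuousOn_norm_rpow_compl_zero _).mul fun y hy => ?_) fun x hx => ?_
    · have h1 := (contDiffAt_radialPow hy β⁻¹).continuousAt
      have h2 : ContinuousAt (fun y => gradSq (fderiv ℝ φ (radialPow β⁻¹ y))) y :=
        ContinuousAt.comp (g := fun x => gradSq (fderiv ℝ φ x))
          (continuous_gradSq.comp (hφ.continuous_fderiv one_ne_zero)).continuousAt h1
      exact (((h1.norm.pow 2).mul h2).const_mul _).continuousWithinAt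
    · have hx' : radialPow β⁻¹ x ∉ tsupport φ := fun h =>
        hx ⟨_, h, by simpa using radialPow_inv_radialPow hκ.ne' x⟩
      have h2 : fderiv ℝ φ (radialPow β⁻¹ x) = 0 := by
        by_contra h
        exact hx' (support_fderiv_subset ℝ h)
      simp [h2, gradSq]
  have hP' : ∫ x, ‖x‖ ^ (-(d : ℝ)) * (‖x‖ ^ 2 * gradSq (fderiv ℝ ψ x)) ≤ β⁻¹ * P := by
    have h1 : β⁻¹ * P = ∫ y, ‖y‖ ^ (-(d : ℝ)) *
        ((β⁻¹) ^ 2 * (‖radialPow β⁻¹ y‖ ^ 2 * gradSq (fderiv ℝ φ (radialPow β⁻¹ y)))) := by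
      rw [hP, integral_norm_rpow_neg_mul hd hκ (fun x => ‖x‖ ^ 2 * gradSq (fderiv ℝ φ x)),
        ← mul_assoc, ← integral_const_mul]
      congr 1
      ext y
      ring
    rw [h1]
    refine integral_mono_of_nonneg (.of_forall fun x => ?_) hInt (.of_forall fun y => ?_)
    · have := gradSq_nonneg (fderiv ℝ ψ x)
      positivity
    · refine mul_le_mul_of_nonneg_left ?_ (by positivity)
      rcases eq_or_ne y 0 with rfl | hy
      · simp [radialPow_zero]
      · exact gradSq_fderiv_comp_radialPow_le hφ hκ1 hy
  have hle : ∫ x, gradSq (fderiv ℝ (fun x => ‖x‖ ^ (-s) • ψ x) x) ≤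
      β⁻¹ * (P + s ^ 2 * β ^ 2 * R) := by
    rw [hDg, hR', ← hs]
    have : β⁻¹ * (P + s ^ 2 * β ^ 2 * R) = β⁻¹ * P + s ^ 2 * (β * R) := by field_simp
    linarith
  rw [hM'] at hsob
  have hfin := hsob.trans (pow_le_pow_left₀ (integral_nonneg fun x => gradSq_nonneg _) hle d)
  set V := ∫ x : EuclideanSpace ℝ (Fin d), (1 + ‖x‖ ^ 2) ^ (-(d : ℝ))
  set M := ∫ x, ‖f x‖ ^ p
  have hA : ((((d : ℝ) * ((d : ℝ) - 2)) ^ ((d : ℝ) / 2)) ^ 2) = ((d : ℝ) * ((d : ℝ) - 2)) ^ d := by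
    rw [← Real.rpow_natCast, ← Real.rpow_mul (by positivity), ← Real.rpow_natCast]
    congr 1
    push_cast
    ring
  rw [mul_pow β⁻¹, inv_pow, le_inv_mul_iff₀ (by positivity)] at hfin
  refine le_of_eq_of_le ?_ hfin
  rw [mul_pow, mul_pow, hA, mul_pow]
  obtain ⟨n, rfl⟩ : ∃ n, d = n + 2 := ⟨d - 2, by omega⟩
  simp only [show n + 2 - 1 = n + 1 by omega, show n + 2 - 2 = n by omega]
  ring

/-- The profile `t / (1 + t ^ 2)` of the ground state in logarithmic coordinates. -/
noncomputable def bubble (t : ℝ) : ℝ := t / (1 + t ^ 2)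

theorem continuous_bubble : Continuous bubble :=
  continuous_id.div (by fun_prop) fun t => by positivity

theorem integrableOn_inv_mul_bubble_pow_mul {n : ℕ} (hn : n ≠ 0) {u : ℝ → ℝ} (hu : Continuous u)
    {B : ℝ} (hB : ∀ t, |u t| ≤ B) :
    IntegrableOn (fun t => t⁻¹ * (bubble t ^ n * u t)) (Set.Ioi 0) := by
  refine Integrable.mono' (g := fun t : ℝ => B * (1 + t ^ 2)⁻¹)
    (integrable_inv_one_add_sq.const_mul B).integrableOn ?_ ?_
  · refine ContinuousOn.aestronglyMeasurable (fun t ht => ?_) measurableSet_Ioi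
    exact (((continuousAt_inv₀ (ne_of_gt ht)).mul
      ((continuous_bubble.pow n).mul hu).continuousAt)).continuousWithinAt
  · refine (ae_restrict_iff' measurableSet_Ioi).2 (.of_forall fun t ht => ?_)
    have ht0 : (0 : ℝ) < t := ht
    have hb0 : 0 ≤ bubble t := by
      rw [bubble]
      positivity
    have hb1 : bubble t ≤ 1 := by
      rw [bubble, div_le_one (by positivity)]
      nlinarith [sq_nonneg (t - 1)]
    have h1 : bubble t ^ n ≤ bubble t := pow_le_of_le_one hb0 hb1 hn
    rw [Real.norm_eq_abs, abs_mul, abs_mul, abs_of_pos (inv_pos.2 ht0), abs_of_nonneg (by positivity)]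
    calc t⁻¹ * (bubble t ^ n * |u t|) ≤ t⁻¹ * (bubble t * B) := by
          have := hB t
          gcongr
      _ = _ := by
          rw [bubble]
          field_simp

theorem hasDerivAt_bubble_pow_mul {n : ℕ} (β A : ℝ) {t : ℝ} (ht : 0 < t) :
    HasDerivAt (fun t => A * n / 2 * (bubble t ^ n * (β ^ 2 * ((1 - t ^ 2) / (1 + t ^ 2)) - β)))
      (t⁻¹ * (bubble t ^ n * (A * ((n : ℝ) / 2) ^ 2 *
        (2 * β ^ 2 * ((1 + t ^ 4) / (1 + t ^ 2) ^ 2) - 2 * β * ((1 - t ^ 2) / (1 + t ^ 2))))) -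
        t⁻¹ * (bubble t ^ (n + 2) * (A * (((n : ℝ) + 2) * n * β ^ 2)))) t := by
  have hp : (1 + t ^ 2) ≠ 0 := by positivity
  have hq : HasDerivAt (fun t : ℝ => t ^ 2) (2 * t) t := by simpa using hasDerivAt_pow 2 t
  have hb : HasDerivAt bubble ((1 * (1 + t ^ 2) - t * (2 * t)) / (1 + t ^ 2) ^ 2) t :=
    (hasDerivAt_id t).div (hq.const_add 1) hp
  have hr : HasDerivAt (fun t : ℝ => (1 - t ^ 2) / (1 + t ^ 2))
      ((-(2 * t) * (1 + t ^ 2) - (1 - t ^ 2) * (2 * t)) / (1 + t ^ 2) ^ 2) t :=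
    (hq.const_sub 1).div (hq.const_add 1) hp
  refine (((hb.fun_pow n).mul ((hr.const_mul (β ^ 2)).sub_const β)).const_mul
    (A * n / 2)).congr_deriv ?_
  rcases n with _ | m
  · simp
  simp only [Nat.add_sub_cancel, show m + 1 + 2 = m + 3 by ring, pow_succ (bubble t)]
  set b := bubble t ^ m
  rw [bubble]
  push_cast
  field_simp
  ring

theorem integral_inv_mul_bubble_pow {n : ℕ} (hn : n ≠ 0) (β A : ℝ) :
    ∫ t in Set.Ioi (0 : ℝ), t⁻¹ * (bubble t ^ n * (A * ((n : ℝ) / 2) ^ 2 *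
        (2 * β ^ 2 * ((1 + t ^ 4) / (1 + t ^ 2) ^ 2) - 2 * β * ((1 - t ^ 2) / (1 + t ^ 2))))) =
      ∫ t in Set.Ioi (0 : ℝ), t⁻¹ * (bubble t ^ (n + 2) * (A * (((n : ℝ) + 2) * n * β ^ 2))) := by
  have hc0 : ∀ t : ℝ, |(1 - t ^ 2) / (1 + t ^ 2)| ≤ 1 := fun t => by
    rw [abs_div, abs_of_pos (show 0 < 1 + t ^ 2 by positivity), div_le_one (by positivity), abs_le]
    constructor <;> nlinarith [sq_nonneg t]
  have hc1 : ∀ t : ℝ, |(1 + t ^ 4) / (1 + t ^ 2) ^ 2| ≤ 1 := fun t => by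
    rw [abs_of_nonneg (by positivity), div_le_one (by positivity)]
    nlinarith [sq_nonneg t]
  have hr : Continuous fun t : ℝ => (1 - t ^ 2) / (1 + t ^ 2) :=
    Continuous.div (by fun_prop) (by fun_prop) fun t => by positivity
  have hq : Continuous fun t : ℝ => (1 + t ^ 4) / (1 + t ^ 2) ^ 2 :=
    Continuous.div (by fun_prop) (by fun_prop) fun t => by positivity
  have h1 : IntegrableOn (fun t => t⁻¹ * (bubble t ^ n * (A * ((n : ℝ) / 2) ^ 2 *
      (2 * β ^ 2 * ((1 + t ^ 4) / (1 + t ^ 2) ^ 2) - 2 * β * ((1 - t ^ 2) / (1 + t ^ 2))))))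
      (Set.Ioi 0) := by
    refine integrableOn_inv_mul_bubble_pow_mul hn (by fun_prop)
      (B := |A * ((n : ℝ) / 2) ^ 2| * (|2 * β ^ 2| * 1 + |2 * β| * 1)) fun t => ?_
    rw [abs_mul]
    refine mul_le_mul_of_nonneg_left ((abs_sub _ _).trans ?_) (abs_nonneg _)
    rw [abs_mul, abs_mul (2 * β)]
    have := hc0 t
    have := hc1 t
    gcongr
  have h2 : IntegrableOn (fun t => t⁻¹ * (bubble t ^ (n + 2) * (A * (((n : ℝ) + 2) * n * β ^ 2))))
      (Set.Ioi 0) :=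
    integrableOn_inv_mul_bubble_pow_mul (by omega) continuous_const fun _ => le_rfl
  have hlim : Filter.Tendsto bubble Filter.atTop (nhds 0) := by
    refine squeeze_zero' (g := fun t : ℝ => t⁻¹) ?_ ?_ tendsto_inv_atTop_zero
    · filter_upwards [Filter.eventually_gt_atTop 0] with t ht
      rw [bubble]
      positivity
    · filter_upwards [Filter.eventually_gt_atTop 0] with t ht
      rw [bubble, div_le_iff₀ (by positivity)]
      field_simp
      linarith
  have hb0 : bubble 0 = 0 := by simp [bubble]
  have h := integral_Ioi_of_hasDerivAt_of_tendsto (a := 0) (m := 0) ?_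
    (fun t ht => hasDerivAt_bubble_pow_mul (n := n) β A ht) (h1.sub h2) ?_
  · rw [integral_sub h1 h2, hb0, zero_pow hn] at h
    linarith
  · exact (continuous_const.mul ((continuous_bubble.pow n).mul
      ((hr.const_mul _).sub continuous_const))).continuousWithinAt
  · have hn0 : Filter.Tendsto (fun t => bubble t ^ n) Filter.atTop (nhds 0) := by
      simpa [zero_pow hn] using hlim.pow n
    have hbd := hn0.zero_mul_isBoundedUnder_le (g := fun t : ℝ =>
      β ^ 2 * ((1 - t ^ 2) / (1 + t ^ 2)) - β) (Filter.isBoundedUnder_of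
        ⟨|β ^ 2| * 1 + |β|, fun t => by
          refine (abs_sub _ _).trans ?_
          rw [abs_mul]
          have := hc0 t
          gcongr⟩)
    simpa using hbd.const_mul (A * n / 2)

theorem integral_norm_rpow_neg_mul_comp_rpow {d : ℕ} (hd : 3 ≤ d) {β : ℝ} (hβ : 0 < β)
    (g : ℝ → ℝ) :
    ∫ x : EuclideanSpace ℝ (Fin d), ‖x‖ ^ (-(d : ℝ)) * g (‖x‖ ^ β) =
      β⁻¹ * ∫ y : EuclideanSpace ℝ (Fin d), ‖y‖ ^ (-(d : ℝ)) * g ‖y‖ := by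
  have : NeZero d := ⟨by omega⟩
  rw [integral_norm_rpow_neg_mul hd (inv_pos.2 hβ)
    fun x : EuclideanSpace ℝ (Fin d) => g (‖x‖ ^ β)]
  congr 1
  refine integral_congr_ae ?_
  filter_upwards [Measure.ae_ne volume 0] with y hy
  rw [norm_radialPow hy, ← Real.rpow_mul (norm_nonneg _), inv_mul_cancel₀ hβ.ne', Real.rpow_one]

theorem integral_norm_rpow_neg_mul_norm {d : ℕ} (hd : 3 ≤ d) (g : ℝ → ℝ) :
    ∫ y : EuclideanSpace ℝ (Fin d), ‖y‖ ^ (-(d : ℝ)) * g ‖y‖ =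
      d * volume.real (Metric.ball (0 : EuclideanSpace ℝ (Fin d)) 1) *
        ∫ t in Set.Ioi (0 : ℝ), t⁻¹ * g t := by
  have : NeZero d := ⟨by omega⟩
  rw [integral_fun_norm_addHaar volume (fun t : ℝ => t ^ (-(d : ℝ)) * g t),
    finrank_euclideanSpace_fin, nsmul_eq_mul, smul_eq_mul, mul_assoc]
  congr 2
  refine setIntegral_congr_fun measurableSet_Ioi fun t ht => ?_
  have ht0 : (0 : ℝ) < t := ht
  obtain ⟨n, rfl⟩ : ∃ n, d = n + 1 := ⟨d - 1, by omega⟩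
  rw [Real.rpow_neg ht0.le, Real.rpow_natCast, smul_eq_mul, Nat.add_sub_cancel, pow_succ]
  field_simp

theorem sum_sq_fderiv_radial {d : ℕ} {g : ℝ → ℝ} {g' : ℝ} {x : EuclideanSpace ℝ (Fin d)}
    (hx : x ≠ 0) (hg : HasDerivAt g g' ‖x‖) :
    ∑ i, (fderiv ℝ (fun x => g ‖x‖) x (EuclideanSpace.single i 1)) ^ 2 = g' ^ 2 := by
  have hx0 : 0 < ‖x‖ := norm_pos_iff.2 hx
  have h := hasFDerivAt_norm_rpow_of_ne hx 1
  simp only [Real.rpow_one, one_mul] at h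
  rw [show fderiv ℝ (fun x => g ‖x‖) x = _ from (hg.comp_hasFDerivAt x h).fderiv]
  have e : ∀ i : Fin d, ((g' • ‖x‖ ^ ((1 : ℝ) - 2) • innerSL ℝ x) (EuclideanSpace.single i 1)) ^ 2 =
      (g' * ‖x‖⁻¹) ^ 2 * x i ^ 2 := fun i => by
    rw [show (1 : ℝ) - 2 = -1 by norm_num, Real.rpow_neg_one]
    simp [EuclideanSpace.inner_single_right]
    ring
  have hn : ∑ i, x i ^ 2 = ‖x‖ ^ 2 := by simp [EuclideanSpace.norm_sq_eq]
  rw [Finset.sum_congr rfl fun i _ => e i, ← Finset.mul_sum, hn]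
  field_simp

theorem hasDerivAt_soliton {β s C r : ℝ} (hr : 0 < r) :
    HasDerivAt (fun r : ℝ => C * (r ^ (β - 1) / (1 + r ^ (2 * β))) ^ s)
      (C * s * (r ^ (β - 1) / (1 + r ^ (2 * β))) ^ s *
        (β * ((1 - (r ^ β) ^ 2) / (1 + (r ^ β) ^ 2)) - 1) / r) r := by
  have hu : ∀ r : ℝ, 0 < r → r ^ (2 * β) = (r ^ β) ^ 2 := fun r hr => by
    rw [← Real.rpow_natCast, ← Real.rpow_mul hr.le]
    congr 1
    push_cast
    ring
  have h1 : HasDerivAt (fun r : ℝ => r ^ (β - 1)) ((β - 1) * r ^ (β - 1 - 1)) r :=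
    Real.hasDerivAt_rpow_const (Or.inl hr.ne')
  have h2 : HasDerivAt (fun r : ℝ => 1 + r ^ (2 * β)) (2 * β * r ^ (2 * β - 1)) r :=
    (Real.hasDerivAt_rpow_const (Or.inl hr.ne')).const_add 1
  have hpos : 0 < 1 + r ^ (2 * β) := by positivity
  have hw : 0 < r ^ (β - 1) / (1 + r ^ (2 * β)) := by positivity
  refine (((h1.fun_div h2 hpos.ne').rpow_const (p := s) (Or.inl hw.ne')).const_mul C).congr_deriv ?_
  rw [Real.rpow_sub_one hw.ne', Real.rpow_sub_one hr.ne' (β - 1), Real.rpow_sub_one hr.ne' (2 * β),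
    hu r hr]
  have hT : 0 < r ^ β := by positivity
  have hq : 0 < r ^ (β - 1) := by positivity
  set w := (r ^ (β - 1) / (1 + (r ^ β) ^ 2)) ^ s
  field_simp
  ring

/-- The kinetic and the potential energy of the ground state soliton. -/
theorem soliton_integrals {d : ℕ} (hd : 3 ≤ d) {β b : ℝ} (hβ : 0 < β)
    (hb : b = (((d : ℝ) - 2) / 2) ^ 2 * (β ^ 2 - 1)) {W : EuclideanSpace ℝ (Fin d) → ℝ}
    (hW : ∀ x, W x = ((d : ℝ) * ((d : ℝ) - 2) * β ^ 2) ^ (((d : ℝ) - 2) / 4) *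
        (‖x‖ ^ (β - 1) / (1 + ‖x‖ ^ (2 * β))) ^ (((d : ℝ) - 2) / 2)) :
    ∫ x : EuclideanSpace ℝ (Fin d), W x ^ (2 * (d : ℝ) / ((d : ℝ) - 2)) =
      β ^ (d - 1) * (((d : ℝ) * ((d : ℝ) - 2)) ^ ((d : ℝ) / 2) *
        ∫ x : EuclideanSpace ℝ (Fin d), (1 + ‖x‖ ^ 2) ^ (-(d : ℝ))) ∧
    ∫ x : EuclideanSpace ℝ (Fin d),
        ((∑ i, (fderiv ℝ W x (EuclideanSpace.single i 1)) ^ 2) + b / ‖x‖ ^ 2 * (W x) ^ 2) =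
      ∫ x : EuclideanSpace ℝ (Fin d), W x ^ (2 * (d : ℝ) / ((d : ℝ) - 2)) := by
  have : NeZero d := ⟨by omega⟩
  have hd' : (3 : ℝ) ≤ d := by exact_mod_cast hd
  have hd2 : (0 : ℝ) < (d : ℝ) - 2 := by linarith
  obtain ⟨n, rfl⟩ : ∃ n, d = n + 2 := ⟨d - 2, by omega⟩
  have hn : n ≠ 0 := by omega
  have hcast : (((n + 2 : ℕ) : ℝ) - 2) = n := by push_cast; ring
  rw [hcast] at hb ⊢
  simp only [hcast] at hW
  rw [hcast] at hd2
  set D : ℝ := ((n + 2 : ℕ) : ℝ) with hD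
  have hD2 : D = (n : ℝ) + 2 := by rw [hD]; push_cast; ring
  set X : ℝ := D * n * β ^ 2 with hX
  have hX0 : 0 < X := by positivity
  set C : ℝ := X ^ ((n : ℝ) / 4) with hC
  have hC0 : 0 < C := by positivity
  have hCp : C ^ (2 * D / n) = X ^ (D / 2) := by
    rw [hC, ← Real.rpow_mul hX0.le]
    congr 1
    field_simp
    norm_num
  have hC2 : X ^ (D / 2) = C ^ 2 * X := by
    rw [hC, ← Real.rpow_natCast, ← Real.rpow_mul hX0.le, ← Real.rpow_add_one hX0.ne', hD2]
    congr 1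
    push_cast
    ring
  have hw : ∀ r : ℝ, 0 < r →
      r ^ (β - 1) / (1 + r ^ (2 * β)) = r⁻¹ * bubble (r ^ β) := fun r hr => by
    have hu : r ^ (2 * β) = (r ^ β) ^ 2 := by
      rw [← Real.rpow_natCast, ← Real.rpow_mul hr.le]
      congr 1
      push_cast
      ring
    rw [hu, Real.rpow_sub_one hr.ne', bubble]
    field_simp
  have hb0 : ∀ r : ℝ, 0 < r → 0 < bubble (r ^ β) := fun r hr => by
    rw [bubble]
    positivity
  have hWp : ∫ x, W x ^ (2 * D / n) = β⁻¹ * ∫ y : EuclideanSpace ℝ (Fin (n + 2)),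
      ‖y‖ ^ (-D) * (bubble ‖y‖ ^ (n + 2) * (C ^ 2 * X)) := by
    rw [← integral_norm_rpow_neg_mul_comp_rpow hd hβ fun t => bubble t ^ (n + 2) * (C ^ 2 * X)]
    refine integral_congr_ae ?_
    filter_upwards [Measure.ae_ne volume 0] with x hx
    have hx0 : 0 < ‖x‖ := norm_pos_iff.2 hx
    have hbx := hb0 _ hx0
    rw [hW, hw _ hx0, Real.mul_rpow hC0.le (by positivity), hCp, hC2, ← Real.rpow_mul (by positivity),
      show (n : ℝ) / 2 * (2 * D / n) = D by field_simp, Real.mul_rpow (by positivity) hbx.le,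
      Real.inv_rpow hx0.le, ← Real.rpow_neg hx0.le, hD, Real.rpow_natCast (bubble _)]
    ring
  have hWQ : ∫ x, ((∑ i, (fderiv ℝ W x (EuclideanSpace.single i 1)) ^ 2) +
      b / ‖x‖ ^ 2 * (W x) ^ 2) = β⁻¹ * ∫ y : EuclideanSpace ℝ (Fin (n + 2)), ‖y‖ ^ (-D) *
        (bubble ‖y‖ ^ n * (C ^ 2 * ((n : ℝ) / 2) ^ 2 *
          (2 * β ^ 2 * ((1 + ‖y‖ ^ 4) / (1 + ‖y‖ ^ 2) ^ 2) -
            2 * β * ((1 - ‖y‖ ^ 2) / (1 + ‖y‖ ^ 2))))) := by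
    rw [← integral_norm_rpow_neg_mul_comp_rpow hd hβ fun t => bubble t ^ n *
      (C ^ 2 * ((n : ℝ) / 2) ^ 2 * (2 * β ^ 2 * ((1 + t ^ 4) / (1 + t ^ 2) ^ 2) -
        2 * β * ((1 - t ^ 2) / (1 + t ^ 2))))]
    refine integral_congr_ae ?_
    filter_upwards [Measure.ae_ne volume 0] with x hx
    have hx0 : 0 < ‖x‖ := norm_pos_iff.2 hx
    have hbx := hb0 _ hx0
    have hWf : W = fun x => C * (‖x‖ ^ (β - 1) / (1 + ‖x‖ ^ (2 * β))) ^ ((n : ℝ) / 2) :=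
      funext hW
    have hsq : ((‖x‖⁻¹ * bubble (‖x‖ ^ β)) ^ ((n : ℝ) / 2)) ^ 2 =
        (‖x‖ ^ n)⁻¹ * bubble (‖x‖ ^ β) ^ n := by
      rw [← Real.rpow_natCast (_ ^ _), ← Real.rpow_mul (by positivity),
        show (n : ℝ) / 2 * ((2 : ℕ) : ℝ) = n by push_cast; ring, Real.rpow_natCast, mul_pow, inv_pow]
    rw [hWf, sum_sq_fderiv_radial hx (hasDerivAt_soliton hx0), Real.rpow_neg hx0.le,
      Real.rpow_natCast ‖x‖ (n + 2), pow_add ‖x‖ n 2, hb]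
    simp only [hw _ hx0]
    set Z := (‖x‖⁻¹ * bubble (‖x‖ ^ β)) ^ ((n : ℝ) / 2)
    rw [div_pow, mul_pow _ _ 2, mul_pow _ Z, mul_pow _ Z, mul_pow, hsq]
    set T := ‖x‖ ^ β
    set B := bubble T ^ n
    field_simp
    ring
  refine ⟨?_, ?_⟩
  · have hV : ∀ y : EuclideanSpace ℝ (Fin (n + 2)), y ≠ 0 →
        ‖y‖ ^ (-D) * (bubble ‖y‖ ^ (n + 2) * (C ^ 2 * X)) =
          (1 + ‖y‖ ^ 2) ^ (-D) * (C ^ 2 * X) := fun y hy => by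
      have hy0 : 0 < ‖y‖ := norm_pos_iff.2 hy
      rw [Real.rpow_neg hy0.le, Real.rpow_neg (by positivity), hD, Real.rpow_natCast,
        Real.rpow_natCast, bubble, div_pow]
      field_simp
    have hXp : X ^ (D / 2) = (D * n) ^ (D / 2) * β ^ (n + 2) := by
      rw [hX, Real.mul_rpow (by positivity) (by positivity), ← Real.rpow_natCast β 2,
        ← Real.rpow_mul hβ.le, ← Real.rpow_natCast β (n + 2)]
      congr 2
      push_cast
      rw [hD2]
      ring
    rw [hWp, integral_congr_ae ((Measure.ae_ne volume 0).mono hV), integral_mul_const, ← hC2, hXp,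
      show n + 2 - 1 = n + 1 by omega]
    field_simp
    ring
  · rw [hWp, hWQ, integral_norm_rpow_neg_mul_norm hd fun t => bubble t ^ n *
      (C ^ 2 * ((n : ℝ) / 2) ^ 2 * (2 * β ^ 2 * ((1 + t ^ 4) / (1 + t ^ 2) ^ 2) -
        2 * β * ((1 - t ^ 2) / (1 + t ^ 2)))),
      integral_norm_rpow_neg_mul_norm hd fun t => bubble t ^ (n + 2) * (C ^ 2 * X),
      integral_inv_mul_bubble_pow hn, hX, hD2]

theorem integral_rpow_neg_one_add_norm_sq_pos {d : ℕ} (hd : 0 < d) :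
    0 < ∫ x : EuclideanSpace ℝ (Fin d), (1 + ‖x‖ ^ 2) ^ (-(d : ℝ)) := by
  have hd' : (0 : ℝ) < d := by exact_mod_cast hd
  have hpos : ∀ x : EuclideanSpace ℝ (Fin d), 0 < (1 + ‖x‖ ^ 2) ^ (-(d : ℝ)) :=
    fun x => by positivity
  have h := integrable_rpow_neg_one_add_norm_sq (E := EuclideanSpace ℝ (Fin d)) (μ := volume)
    (r := 2 * d) (by simp; linarith)
  rw [show -(2 * (d : ℝ)) / 2 = -(d : ℝ) by ring] at h
  refine (integral_pos_iff_support_of_nonneg (fun x => (hpos x).le) h).2 ?_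
  rw [Function.support_eq_univ fun x => (hpos x).ne']
  exact isOpen_univ.measure_pos volume Set.univ_nonempty

theorem le_rpow_mul_of_sq_mul_pow_le {n : ℕ} (hn : n ≠ 0) {K V Q θ : ℝ} (hK : 0 < K)
    (hQ : 0 ≤ Q) (hθ : 0 ≤ θ) (hQK : Q ≤ θ * K) (h : K ^ 2 * V ^ n ≤ Q ^ (n + 2)) :
    V ≤ θ ^ (2 / (n : ℝ)) * Q := by
  have hn' : (n : ℝ) ≠ 0 := Nat.cast_ne_zero.2 hn
  refine le_of_pow_le_pow_left₀ hn (by positivity) ?_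
  have e : (θ ^ (2 / (n : ℝ))) ^ n = θ ^ 2 := by
    rw [← Real.rpow_natCast (θ ^ _), ← Real.rpow_mul hθ, div_mul_cancel₀ _ hn']
    exact_mod_cast Real.rpow_natCast θ 2
  rw [mul_pow, e]
  refine le_of_mul_le_mul_left ?_ (show 0 < K ^ 2 by positivity)
  calc K ^ 2 * V ^ n ≤ Q ^ (n + 2) := h
    _ = Q ^ 2 * Q ^ n := by ring
    _ ≤ (θ * K) ^ 2 * Q ^ n := by gcongr
    _ = K ^ 2 * (θ ^ 2 * Q ^ n) := by ring

theorem coercivity_of_sq_mul_pow_le {n : ℕ} (hn : n ≠ 0) {δ K V Q E : ℝ} (hδ : δ < 1)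
    (hK : 0 < K) (hV : 0 ≤ V) (hQ : 0 ≤ Q) (hQK : Q ≤ K)
    (hE : E = 1 / 2 * Q - n / (2 * (n + 2)) * V) (hEK : E ≤ (1 - δ) * (K / (n + 2)))
    (h : K ^ 2 * V ^ n ≤ Q ^ (n + 2)) :
    Q ≤ (1 - δ) * K ∧ (1 - (1 - δ) ^ (2 / (n : ℝ))) * Q ≤ Q - V ∧
      (1 - (1 - δ) ^ (2 / (n : ℝ))) * Q ≤ 2 * E ∧ 2 * E ≤ Q := by
  have hVQ : V ≤ Q := by
    simpa using le_rpow_mul_of_sq_mul_pow_le hn hK hQ zero_le_one (by simpa using hQK) h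
  have hm : (n : ℝ) / (2 * (n + 2)) = 1 / 2 - 1 / (n + 2) := by field_simp; ring
  have hm0 : (0 : ℝ) < 1 / (n + 2) := by positivity
  have hm1 : (0 : ℝ) ≤ n / (2 * (n + 2)) := by positivity
  have hQδ : Q ≤ (1 - δ) * K := by
    refine le_of_mul_le_mul_left ?_ hm0
    calc 1 / ((n : ℝ) + 2) * Q ≤ E := by
          rw [hE]
          have := mul_le_mul_of_nonneg_left hVQ hm1
          rw [hm] at this ⊢
          linarith
      _ ≤ (1 - δ) * (K / (n + 2)) := hEK
      _ = 1 / (n + 2) * ((1 - δ) * K) := by ring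
  have hVδ := le_rpow_mul_of_sq_mul_pow_le hn hK hQ (by linarith) hQδ h
  have h2 : Q - V ≤ 2 * E := by
    rw [hE, hm]
    have := mul_nonneg hm0.le hV
    linarith
  refine ⟨hQδ, by linarith, by linarith, ?_⟩
  rw [hE]
  have := mul_nonneg hm1 hV
  linarith

theorem one_sub_rpow_pos {δ s : ℝ} (hδ : 0 < δ) (hδ' : δ < 1) (hs : 0 < s) :
    0 < 1 - (1 - δ) ^ s :=
  sub_pos.2 (Real.rpow_lt_one (by linarith) (by linarith) hs)

/-- Coercivity / energy trapping below the ground state: with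
`W = W_{min(a,0)}`, `K = Q_{min(a,0)}(W)`, `E_W = E_{min(a,0)}(W)`, there exist
`δ₁, c > 0` (depending on `d, a, δ₀`) such that any smooth compactly supported
`f`, supported away from the origin, with `E_a(f) ≤ (1-δ₀)E_W` and
`Q_a(f) ≤ K` satisfies: (1) `Q_a(f) ≤ (1-δ₁)K`;
(2) `∫ |∇f|² + (a/|x|²)|f|² - |f|^{2d/(d-2)} ≥ c·Q_a(f)`;
(3) `c·Q_a(f) ≤ 2E_a(f) ≤ Q_a(f)`. -/
theorem coercivity_below_threshold
    (d : ℕ) (hd : 3 ≤ d) (a : ℝ) (ha : -(((d : ℝ) - 2) / 2) ^ 2 < a)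
    (δ₀ : ℝ) (hδ₀ : 0 < δ₀) (hδ₀' : δ₀ < 1)
    (β : ℝ) (hβ : β = Real.sqrt (1 + 4 * min a 0 / ((d : ℝ) - 2) ^ 2))
    (W : EuclideanSpace ℝ (Fin d) → ℝ)
    (hW : ∀ x, W x = ((d : ℝ) * ((d : ℝ) - 2) * β ^ 2) ^ (((d : ℝ) - 2) / 4) *
        (‖x‖ ^ (β - 1) / (1 + ‖x‖ ^ (2 * β))) ^ (((d : ℝ) - 2) / 2))
    (K : ℝ)
    (hK : K = ∫ x : EuclideanSpace ℝ (Fin d),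
        ((∑ i, (fderiv ℝ W x (EuclideanSpace.single i 1)) ^ 2)
          + min a 0 / ‖x‖ ^ 2 * (W x) ^ 2))
    (EW : ℝ)
    (hEW : EW = (1 / 2) * K - (((d : ℝ) - 2) / (2 * (d : ℝ))) *
        ∫ x : EuclideanSpace ℝ (Fin d), W x ^ (2 * (d : ℝ) / ((d : ℝ) - 2))) :
    ∃ δ₁ : ℝ, 0 < δ₁ ∧ ∃ c : ℝ, 0 < c ∧
      ∀ f : EuclideanSpace ℝ (Fin d) → ℂ,
        ContDiff ℝ (⊤ : ℕ∞) f → HasCompactSupport f →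
        (0 : EuclideanSpace ℝ (Fin d)) ∉ tsupport f →
        ∀ Qf Ef : ℝ,
        Qf = (∫ x : EuclideanSpace ℝ (Fin d),
            ((∑ i, ‖fderiv ℝ f x (EuclideanSpace.single i 1)‖ ^ 2)
              + a / ‖x‖ ^ 2 * ‖f x‖ ^ 2)) →
        Ef = (1 / 2) * Qf - (((d : ℝ) - 2) / (2 * (d : ℝ))) *
            (∫ x : EuclideanSpace ℝ (Fin d),
              ‖f x‖ ^ (2 * (d : ℝ) / ((d : ℝ) - 2))) →
        Ef ≤ (1 - δ₀) * EW → Qf ≤ K →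
        (Qf ≤ (1 - δ₁) * K
          ∧ (∫ x : EuclideanSpace ℝ (Fin d),
              ((∑ i, ‖fderiv ℝ f x (EuclideanSpace.single i 1)‖ ^ 2)
                + a / ‖x‖ ^ 2 * ‖f x‖ ^ 2
                - ‖f x‖ ^ (2 * (d : ℝ) / ((d : ℝ) - 2)))) ≥ c * Qf
          ∧ c * Qf ≤ 2 * Ef ∧ 2 * Ef ≤ Qf) := by
  have hd' : (3 : ℝ) ≤ d := by exact_mod_cast hd
  have hd2 : (0 : ℝ) < (d : ℝ) - 2 := by linarith
  have hn : ((d - 2 : ℕ) : ℝ) = (d : ℝ) - 2 := by rw [Nat.cast_sub (by omega)]; norm_num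
  have hn0 : d - 2 ≠ 0 := by omega
  have hmin : -(((d : ℝ) - 2) / 2) ^ 2 < min a 0 := lt_min ha (by
    have : 0 < (((d : ℝ) - 2) / 2) ^ 2 := by positivity
    linarith)
  have hrad : 0 < 1 + 4 * min a 0 / ((d : ℝ) - 2) ^ 2 := by
    have h : -1 < 4 * min a 0 / ((d : ℝ) - 2) ^ 2 := by
      rw [lt_div_iff₀ (by positivity)]
      linarith
    linarith
  have hβ0 : 0 < β := hβ ▸ Real.sqrt_pos.2 hrad
  have hβ2 : β ^ 2 = 1 + 4 * min a 0 / ((d : ℝ) - 2) ^ 2 := by rw [hβ, Real.sq_sqrt hrad.le]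
  have hβ1 : β ≤ 1 := by
    have h : 4 * min a 0 / ((d : ℝ) - 2) ^ 2 ≤ 0 :=
      div_nonpos_of_nonpos_of_nonneg (by linarith [min_le_right a 0]) (by positivity)
    refine (sq_le_one_iff₀ hβ0.le).1 ?_
    linarith
  have hb : min a 0 = (((d : ℝ) - 2) / 2) ^ 2 * (β ^ 2 - 1) := by
    rw [hβ2]
    field_simp
    ring
  obtain ⟨hWp, hWQ⟩ := soliton_integrals hd hβ0 hb hW
  rw [← hK] at hWQ
  rw [← hWQ] at hWp hEW
  have hK0 : 0 < K := by
    have := integral_rpow_neg_one_add_norm_sq_pos (d := d) (by omega)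
    rw [hWp]
    positivity
  have hEW' : EW = K / (((d - 2 : ℕ) : ℝ) + 2) := by
    rw [hEW, hn]
    field_simp
    ring
  refine ⟨δ₀, hδ₀, _, one_sub_rpow_pos hδ₀ hδ₀' (show 0 < 2 / ((d - 2 : ℕ) : ℝ) by
    rw [hn]; positivity), fun f hf hfc hf0 Qf Ef hQf hEf hle hQK => ?_⟩
  have hf1 : ContDiff ℝ 1 f := hf.of_le (by exact_mod_cast le_top)
  obtain ⟨hQ0, hHS⟩ := sharp_hardy_sobolev hd hβ0 hβ1 hb hf1 hfc hf0
  rw [← hWp] at hHS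
  have hp0 : 0 < 2 * (d : ℝ) / ((d : ℝ) - 2) := by positivity
  have hG : Integrable fun x => ∑ i, ‖fderiv ℝ f x (EuclideanSpace.single i 1)‖ ^ 2 :=
    integrable_finsetSum _ fun i _ => integrable_norm_fderiv_apply_sq hf1 hfc _
  have hR : Integrable fun x => (‖x‖ ^ 2)⁻¹ * ‖f x‖ ^ 2 := by
    refine integrable_of_continuousOn_compl_zero hfc hf0 ?_ fun x hx => by
      simp [image_eq_zero_of_notMem_tsupport hx]
    refine ContinuousOn.mul (ContinuousOn.inv₀ (by fun_prop) fun x hx => ?_)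
      (hf1.continuous.norm.pow 2).continuousOn
    have := norm_pos_iff.2 (show x ≠ 0 from hx)
    positivity
  have hP : Integrable fun x => ‖f x‖ ^ (2 * (d : ℝ) / ((d : ℝ) - 2)) := by
    refine (hf1.continuous.norm.rpow_const fun x => .inr hp0.le).integrable_of_hasCompactSupport
      (HasCompactSupport.intro' hfc (isClosed_tsupport f) fun x hx => ?_)
    rw [image_eq_zero_of_notMem_tsupport hx, norm_zero, Real.zero_rpow hp0.ne']
  have hpot : (fun x => a / ‖x‖ ^ 2 * ‖f x‖ ^ 2) = fun x => a * ((‖x‖ ^ 2)⁻¹ * ‖f x‖ ^ 2) := by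
    ext x
    ring
  have hA : Integrable fun x => a / ‖x‖ ^ 2 * ‖f x‖ ^ 2 := hpot ▸ hR.const_mul a
  have hQ : Qf = (∫ x, gradSq (fderiv ℝ f x)) + a * ∫ x, (‖x‖ ^ 2)⁻¹ * ‖f x‖ ^ 2 := by
    rw [hQf, integral_add hG hA, hpot, integral_const_mul]
    rfl
  have hR0 : 0 ≤ ∫ x, (‖x‖ ^ 2)⁻¹ * ‖f x‖ ^ 2 := integral_nonneg fun x => by positivity
  have hQle : (∫ x, gradSq (fderiv ℝ f x)) + min a 0 * ∫ x, (‖x‖ ^ 2)⁻¹ * ‖f x‖ ^ 2 ≤ Qf := by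
    rw [hQ]
    gcongr
    exact min_le_left a 0
  have hmain := coercivity_of_sq_mul_pow_le hn0 hδ₀' hK0
    (integral_nonneg fun x : EuclideanSpace ℝ (Fin d) =>
      Real.rpow_nonneg (norm_nonneg (f x)) (2 * (d : ℝ) / ((d : ℝ) - 2)))
    (hQ0.trans hQle) hQK (by rw [hn, sub_add_cancel]; exact hEf) (hEW' ▸ hle)
    (by rw [Nat.sub_add_cancel (by omega)]; exact hHS.trans (pow_le_pow_left₀ hQ0 hQle d))
  rw [integral_sub (hG.fun_add hA) hP, ← hQf]
  exact hmain
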